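/- arXiv:2103.01784 — 3 statements merged into one kernel-verified Lean document; each statement's English description precedes it below -/
import Mathlib

section
/- Let p₁, p₂ ∈ 𝒪_K be two odd prime elements with v_{p₁} ≠ v_{p₂}. Then the equation x₀² − p₁x₁² − p₂x₂² = 0 has a solution (x₀, x₁, x₂) ≠ (0,0,0) in the completion K_{v_{p₁}} if and only if p₂ is a square in K_{v_{p₁}}. -/
open NumberField IsDedekindDomain

theorem isSquare_one_add_of_norm_lt_one {F : Type*} [NormedField F] [IsUltrametricDist F]
    [CompleteSpace F] (h2 : ‖(2 : F)‖ = 1) {t : F} (ht : ‖t‖ < 1) : IsSquare (1 + t) := by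
  have h20 : (2 : F) ≠ 0 := norm_ne_zero_iff.mp (by simp [h2])
  let f : F → F := fun s ↦ (t - s ^ 2) / 2
  have hmaps : Set.MapsTo f (Metric.closedBall 0 ‖t‖) (Metric.closedBall 0 ‖t‖) := by
    intro s hs
    rw [mem_closedBall_zero_iff] at hs ⊢
    simp only [f, norm_div, h2, div_one]
    rw [sub_eq_add_neg]
    refine (IsUltrametricDist.norm_add_le_max t (-s ^ 2)).trans (max_le le_rfl ?_)
    rw [norm_neg, norm_pow]
    nlinarith [norm_nonneg s]
  have hcontr : ContractingWith ‖t‖₊ (hmaps.restrict f _ _) := by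
    refine ⟨ht, LipschitzWith.of_dist_le_mul ?_⟩
    rintro ⟨a, ha⟩ ⟨b, hb⟩
    rw [mem_closedBall_zero_iff] at ha hb
    have hsub : f a - f b = (b + a) * (b - a) / 2 := by
      simp only [f]
      ring
    simp only [Subtype.dist_eq, Set.MapsTo.val_restrict_apply, coe_nnnorm]
    rw [dist_eq_norm, hsub, norm_div, norm_mul, h2, div_one, dist_comm, dist_eq_norm]
    gcongr
    exact (IsUltrametricDist.norm_add_le_max b a).trans (max_le hb ha)
  obtain ⟨s, -, hs, -⟩ := hcontr.exists_fixedPoint' Metric.isClosed_closedBall.isComplete hmaps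
    (Metric.mem_closedBall_self (norm_nonneg t)) (edist_ne_top _ _)
  have hs' : (t - s ^ 2) / 2 = s := hs
  refine ⟨1 + s, ?_⟩
  rw [div_eq_iff h20] at hs'
  linear_combination hs'

theorem WithZero.sq_ne_exp_neg_one (x : WithZero (Multiplicative ℤ)) :
    x ^ 2 ≠ WithZero.exp (-1 : ℤ) := by
  intro h
  have hx : x ≠ 0 := by
    rintro rfl
    rw [zero_pow two_ne_zero] at h
    exact WithZero.exp_ne_zero h.symm
  have := congrArg WithZero.log h
  rw [WithZero.log_pow, WithZero.log_exp, nsmul_eq_mul] at this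
  push_cast at this
  lia

/-- Over a field with a valuation in which `π` has odd value and `u` is a unit, a nontrivial zero of
`x₀² - π x₁² - u x₂²` forces `u` to be congruent to the square of a unit. -/
theorem Valuation.exists_sq_sub_lt_one {F : Type*} [Field F]
    (v : Valuation F (WithZero (Multiplicative ℤ))) {π u : F} (hπ : v π = WithZero.exp (-1 : ℤ))
    (hu : v u = 1) {x₀ x₁ x₂ : F} (hx : ¬(x₀ = 0 ∧ x₁ = 0 ∧ x₂ = 0))
    (h : x₀ ^ 2 - π * x₁ ^ 2 - u * x₂ ^ 2 = 0) :
    ∃ y, v y = 1 ∧ v (u - y ^ 2) < 1 := by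
  have hne (a b : F) (hb : b ≠ 0) : v (a ^ 2) ≠ v (π * b ^ 2) := by
    intro hab
    refine WithZero.sq_ne_exp_neg_one (v (a / b)) ?_
    have hvb : v b ≠ 0 := v.ne_zero_iff.mpr hb
    rw [map_div₀, div_pow, div_eq_iff (pow_ne_zero 2 hvb), ← hπ]
    simpa using hab
  have hx₂ : x₂ ≠ 0 := by
    rintro rfl
    have hx₁ : x₁ = 0 := by
      by_contra hx₁
      refine hne x₀ x₁ hx₁ (congrArg v ?_)
      linear_combination h
    subst hx₁
    simp_all
  obtain ⟨y, z, hyz⟩ : ∃ y z : F, u = y ^ 2 - π * z ^ 2 := by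
    refine ⟨x₀ / x₂, x₁ / x₂, ?_⟩
    field_simp
    linear_combination -h
  have hπ1 : v π < 1 := by
    rw [hπ, ← WithZero.exp_zero, WithZero.exp_lt_exp]
    simp
  have hmax : v (y ^ 2) ≠ v (π * z ^ 2) := by
    by_cases hz : z = 0
    · subst hz
      intro h0
      simp_all
    · exact hne y z hz
  have hone : max (v (y ^ 2)) (v (π * z ^ 2)) = 1 := by
    rw [← v.map_neg (π * z ^ 2)] at hmax ⊢
    rw [← v.map_add_of_distinct_val hmax, ← sub_eq_add_neg, ← hyz, hu]
  have hzne : v (π * z ^ 2) ≠ 1 := by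
    intro hz
    have hz0 : z ≠ 0 := by
      rintro rfl
      simp at hz
    exact hne 1 z hz0 (by simpa using hz.symm)
  have hzlt : v (π * z ^ 2) < 1 := lt_of_le_of_ne (hone ▸ le_max_right _ _) hzne
  have hy : v (y ^ 2) = 1 := by
    rcases max_choice (v (y ^ 2)) (v (π * z ^ 2)) with hc | hc
    · rw [← hc, hone]
    · exact absurd (hc.symm.trans hone) hzne
  refine ⟨y, ?_, ?_⟩
  · rw [map_pow] at hy
    exact (pow_eq_one_iff_left two_ne_zero).mp hy
  · rw [hyz, show y ^ 2 - π * z ^ 2 - y ^ 2 = -(π * z ^ 2) by ring, v.map_neg]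
    exact hzlt

namespace NumberField

variable {K : Type*} [Field K] [NumberField K] (v : HeightOneSpectrum (𝓞 K))

theorem valued_algebraMap_adicCompletion (r : 𝓞 K) :
    Valued.v (algebraMap (𝓞 K) (v.adicCompletion K) r) = v.intValuation r :=
  (v.valuedAdicCompletion_eq_valuation r).trans (v.valuation_of_algebraMap r)

end NumberField

/-- Let `p₁, p₂` be two odd prime elements of `𝓞 K` with distinct associated finite places.
Then `x₀² − p₁x₁² − p₂x₂² = 0` has a nontrivial solution in the completion `K_{v_{p₁}}`
if and only if `p₂` is a square in `K_{v_{p₁}}`. -/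
theorem hilbert_symbol_odd_primes_iff_isSquare
    (K : Type*) [Field K] [NumberField K]
    (p₁ p₂ : 𝓞 K) (hp₁ : Prime p₁) (hp₂ : Prime p₂)
    (v₁ v₂ : HeightOneSpectrum (𝓞 K))
    (hv₁ : v₁.asIdeal = Ideal.span {p₁}) (hv₂ : v₂.asIdeal = Ideal.span {p₂})
    (hodd₁ : (2 : 𝓞 K) ∉ v₁.asIdeal) (hodd₂ : (2 : 𝓞 K) ∉ v₂.asIdeal)
    (hne : v₁ ≠ v₂) :
    (∃ x₀ x₁ x₂ : v₁.adicCompletion K, ¬(x₀ = 0 ∧ x₁ = 0 ∧ x₂ = 0) ∧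
        x₀ ^ 2 - algebraMap (𝓞 K) (v₁.adicCompletion K) p₁ * x₁ ^ 2
          - algebraMap (𝓞 K) (v₁.adicCompletion K) p₂ * x₂ ^ 2 = 0) ↔
      IsSquare (algebraMap (𝓞 K) (v₁.adicCompletion K) p₂) := by
  constructor
  · rintro ⟨x₀, x₁, x₂, hx, h⟩
    have hπ : Valued.v (algebraMap (𝓞 K) (v₁.adicCompletion K) p₁) = WithZero.exp (-1 : ℤ) := by
      rw [valued_algebraMap_adicCompletion, v₁.intValuation_singleton hp₁.ne_zero hv₁]
    have hp₂v₁ : p₂ ∉ v₁.asIdeal := fun hmem ↦ by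
      refine hne (HeightOneSpectrum.ext (v₂.isMaximal.eq_of_le v₁.isPrime.ne_top ?_).symm)
      rwa [hv₂, Ideal.span_singleton_le_iff_mem]
    have hu : Valued.v (algebraMap (𝓞 K) (v₁.adicCompletion K) p₂) = 1 := by
      rwa [valued_algebraMap_adicCompletion, HeightOneSpectrum.intValuation_eq_one_iff]
    have h2 : ‖(2 : v₁.adicCompletion K)‖ = 1 := by
      rw [le_antisymm_iff, Valued.toNormedField.norm_le_one_iff,
        Valued.toNormedField.one_le_norm_iff, ← le_antisymm_iff,
        ← map_ofNat (algebraMap (𝓞 K) (v₁.adicCompletion K)) 2]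
      rwa [valued_algebraMap_adicCompletion, HeightOneSpectrum.intValuation_eq_one_iff]
    obtain ⟨y, hy, hlt⟩ := Valued.v.exists_sq_sub_lt_one hπ hu hx h
    have hy0 : y ≠ 0 := by
      rintro rfl
      simp at hy
    set u := algebraMap (𝓞 K) (v₁.adicCompletion K) p₂
    have ht : ‖(u - y ^ 2) / y ^ 2‖ < 1 := by
      rw [Valued.toNormedField.norm_lt_one_iff]
      simpa [hy] using hlt
    have hsq := (isSquare_one_add_of_norm_lt_one h2 ht).mul (IsSquare.sq y)
    convert! hsq using 1
    field_simp
    ring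
  · rintro ⟨y, hy⟩
    refine ⟨y, 0, 1, by simp, ?_⟩
    rw [hy]
    ring
end

section
/- Let p₁, p₂ ∈ 𝒪_K be two odd prime elements with v_{p₁} ≠ v_{p₂}, and let I = p₁p₂𝒪_K. Then there exists x ∈ 𝒪_K whose image in 𝒪_K/I is invertible, such that for every a ∈ 𝒪_K with a ≡ x mod I: the equation x₀² − p₁x₁² − a·x₂² = 0 has no solution (x₀,x₁,x₂) ≠ (0,0,0) in K_{v_{p₁}}, while the equation x₀² − p₂x₁² − a·x₂² = 0 has a solution (x₀,x₁,x₂) ≠ (0,0,0) in K_{v_{p₂}}. -/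
open Filter Topology

namespace Valued

variable {F Γ₀ : Type*} [Field F] [LinearOrderedCommGroupWithZero Γ₀] [Valued F Γ₀]

lemma tendsto_zero_of_v_le_pow [MulArchimedean Γ₀] {f : ℕ → F} {c : Γ₀} (hc : c < 1)
    (hf : ∀ n, v (f n) ≤ c ^ n) : Tendsto f atTop (𝓝 0) := by
  simp only [(hasBasis_nhds_zero _ _).tendsto_right_iff, Set.mem_ofPred_eq, eventually_atTop,
    forall_const]
  intro γ
  let w : Valuation F Γ₀ := v
  obtain ⟨n, hn⟩ := exists_pow_lt₀ hc
    (Units.map (MonoidWithZeroHom.ValueGroup₀.embedding (f := (.ofClass w))) γ)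
  refine ⟨n, fun m hm ↦ ?_⟩
  rw [Valuation.restrict_lt_iff_lt_embedding]
  exact ((hf m).trans (pow_le_pow_right_of_le_one' hc.le hm)).trans_lt hn

/-- In a complete valued field of rank at most one in which `2` is a unit, every element congruent
to `1` modulo the maximal ideal is a square. -/
theorem isSquare_of_v_sub_one_lt_one [MulArchimedean Γ₀] [CompleteSpace F]
    (h2 : v (2 : F) = 1) {a : F} (ha : v (a - 1) < 1) : IsSquare a := by
  have h2' : (2 : F) ≠ 0 := by
    rintro h
    simp [h] at h2
  set c := v (a - 1)
  let s : ℕ → F := fun n ↦ Nat.rec 1 (fun _ t ↦ t - (t ^ 2 - a) / 2) n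
  have hs : ∀ n, s (n + 1) = s n - (s n ^ 2 - a) / 2 := fun n ↦ rfl
  have key : ∀ n, v (s n - 1) ≤ c ∧ v (s n ^ 2 - a) ≤ c ^ (n + 1) := by
    intro n
    induction n with
    | zero => simp [s, c, Valuation.map_sub_swap]
    | succ n ih =>
      obtain ⟨h₁, h₂⟩ := ih
      have hle : v (s n ^ 2 - a) ≤ c := h₂.trans (pow_le_of_le_one zero_le ha.le n.succ_ne_zero)
      constructor
      · rw [hs, sub_right_comm]
        refine (Valuation.map_sub _ _ _).trans (max_le h₁ ?_)
        simpa [h2] using hle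
      · have : s (n + 1) ^ 2 - a = (s n ^ 2 - a) * ((s n ^ 2 - a) / (2 * 2) - (s n - 1)) := by
          rw [hs]
          field_simp
          ring
        rw [this, map_mul, pow_succ c]
        refine mul_le_mul' h₂ ((Valuation.map_sub _ _ _).trans (max_le ?_ h₁))
        simpa [h2] using hle
  have he : Tendsto (fun n ↦ s n ^ 2 - a) atTop (𝓝 0) :=
    tendsto_zero_of_v_le_pow ha fun n ↦ (key n).2.trans
      (pow_le_pow_right_of_le_one' ha.le n.le_succ)
  have hd : Tendsto (fun n ↦ s (n + 1) - s n) atTop (𝓝 0) := by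
    refine tendsto_zero_of_v_le_pow ha fun n ↦ ?_
    simpa [hs, h2] using (key n).2.trans (pow_le_pow_right_of_le_one' ha.le n.le_succ)
  have : NonarchimedeanRing F := ⟨fun U hU ↦ by
    obtain ⟨γ, hγ⟩ := mem_nhds_zero.mp hU
    exact ⟨⟨Valuation.ltAddSubgroup v.restrict γ, isOpen_ball _ _⟩, hγ⟩⟩
  have hsum : Summable fun n ↦ s (n + 1) - s n :=
    NonarchimedeanAddGroup.summable_of_tendsto_cofinite_zero (Nat.cofinite_eq_atTop ▸ hd)
  have hlim := hsum.hasSum.tendsto_sum_nat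
  simp only [Finset.sum_range_sub] at hlim
  have hlim' := (hlim.add_const (s 0)).pow 2 |>.sub_const a
  simp only [sub_add_cancel] at hlim'
  exact ⟨_, by rw [← sq]; exact (sub_eq_zero.mp (tendsto_nhds_unique hlim' he)).symm⟩

end Valued

namespace IsDedekindDomain.HeightOneSpectrum

open WithZero

variable {R K : Type*} [CommRing R] [IsDedekindDomain R] [Field K] [Algebra R K]
  [IsFractionRing R K] (v : HeightOneSpectrum R)

lemma valued_algebraMap_adicCompletion (r : R) :
    Valued.v (algebraMap R (v.adicCompletion K) r) = v.intValuation r :=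
  (valuedAdicCompletion_eq_valuation v r).trans (v.valuation_of_algebraMap r)

variable {v} in
/-- The image of `R` is dense in the ring of integers, to first order. -/
lemma exists_valued_sub_algebraMap_lt_one {u : v.adicCompletion K} (hu : Valued.v u ≤ 1) :
    ∃ r : R, Valued.v (u - algebraMap R (v.adicCompletion K) r) < 1 := by
  have hopen : IsOpen {y : v.adicCompletion K | Valued.v (y - u) < 1} := by
    have := (Valued.isOpen_ball (v.adicCompletion K) 1).preimage (continuous_sub_right u)
    simpa [Valuation.restrict_lt_one_iff] using this
  obtain ⟨k, hk⟩ := (denseRange_algebraMap (K := K) v).exists_mem_open hopen ⟨u, by simp⟩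
  have hk' : Valued.v (algebraMap K (v.adicCompletion K) k) ≤ 1 := by
    rw [← sub_add_cancel (algebraMap K (v.adicCompletion K) k) u]
    exact (Valuation.map_add _ _ _).trans (max_le (le_of_lt hk) hu)
  have hval (k : K) : Valued.v (algebraMap K (v.adicCompletion K) k) = v.valuation K k :=
    valuedAdicCompletion_eq_valuation' v k
  rw [hval] at hk'
  obtain ⟨r, hr⟩ := v.exists_valuation_sub_lt_of_integer hk' 1
  refine ⟨r, ?_⟩
  rw [← hval, map_sub, ← IsScalarTower.algebraMap_apply] at hr
  rw [Valuation.map_sub_swap, ← sub_add_sub_cancel _ (algebraMap K (v.adicCompletion K) k)]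
  exact Valuation.map_add_lt _ hr hk

variable {v} in
lemma valued_sq_sub_eq_sq {a : R} (ha : ¬ IsSquare (Ideal.Quotient.mk v.asIdeal a))
    (u : v.adicCompletion K) :
    ∃ w : ℤᵐ⁰, w ≠ 0 ∧ Valued.v (u ^ 2 - algebraMap R (v.adicCompletion K) a) = w ^ 2 := by
  have ha' : Valued.v (algebraMap R (v.adicCompletion K) a) = 1 := by
    rw [valued_algebraMap_adicCompletion, intValuation_eq_one_iff]
    intro h
    simp [Ideal.Quotient.eq_zero_iff_mem.mpr h] at ha
  rcases lt_or_ge 1 (Valued.v u) with hu | hu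
  · refine ⟨Valued.v u, (zero_lt_one.trans hu).ne', ?_⟩
    rw [Valuation.map_sub_eq_of_lt_left, map_pow]
    rw [map_pow, ha']
    exact one_lt_pow₀ hu two_ne_zero
  · refine ⟨1, one_ne_zero, ?_⟩
    rw [one_pow]
    refine le_antisymm ((Valuation.map_sub _ _ _).trans (max_le ?_ ha'.le)) ?_
    · rw [map_pow]
      exact pow_le_one₀ zero_le hu
    by_contra! hlt
    obtain ⟨r, hr⟩ := exists_valued_sub_algebraMap_lt_one hu
    refine ha ⟨Ideal.Quotient.mk _ r, ?_⟩
    rw [← map_mul, Ideal.Quotient.eq, ← intValuation_lt_one_iff_mem,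
      ← valued_algebraMap_adicCompletion (K := K)]
    set φ := algebraMap R (v.adicCompletion K)
    have h : φ (a - r * r) = (u - φ r) * (u + φ r) - (u ^ 2 - φ a) := by
      simp only [map_sub, map_mul]
      ring
    rw [h]
    refine Valuation.map_sub_lt _ ?_ hlt
    rw [map_mul]
    refine mul_lt_one_of_lt_of_le hr ((Valuation.map_add _ _ _).trans (max_le hu ?_))
    rw [valued_algebraMap_adicCompletion]
    exact v.intValuation_le_one r

lemma exp_neg_one_mul_sq_ne_sq (w z : ℤᵐ⁰) (hw : w ≠ 0) : exp (-1) * z ^ 2 ≠ w ^ 2 := by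
  intro h
  have hz : z ≠ 0 := by
    rintro rfl
    exact pow_ne_zero 2 hw (by simpa using h.symm)
  have := congrArg log h
  rw [log_mul (by simp) (by simpa), log_pow, log_pow, log_exp] at this
  simp only [nsmul_eq_mul] at this
  lia

variable {v} in
/-- The Hilbert symbol of a prime element and a non-square unit is not `1`. -/
theorem not_exists_sq_sub_mul_sq_sub_mul_sq_eq_zero {p a : R} (hp : p ≠ 0)
    (hv : v.asIdeal = Ideal.span {p}) (ha : ¬ IsSquare (Ideal.Quotient.mk v.asIdeal a)) :
    ¬ ∃ x₀ x₁ x₂ : v.adicCompletion K, ¬(x₀ = 0 ∧ x₁ = 0 ∧ x₂ = 0) ∧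
      x₀ ^ 2 - algebraMap R (v.adicCompletion K) p * x₁ ^ 2
        - algebraMap R (v.adicCompletion K) a * x₂ ^ 2 = 0 := by
  rintro ⟨x₀, x₁, x₂, hx, h⟩
  have hvp : Valued.v (algebraMap R (v.adicCompletion K) p) = exp (-1) := by
    rw [valued_algebraMap_adicCompletion, v.intValuation_singleton hp hv]
  by_cases h₂ : x₂ = 0
  · have h' : algebraMap R (v.adicCompletion K) p * x₁ ^ 2 = x₀ ^ 2 := by
      rw [h₂] at h
      linear_combination -h
    by_cases h₀ : x₀ = 0
    · have hp' : algebraMap R (v.adicCompletion K) p ≠ 0 := by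
        intro h
        rw [h, map_zero] at hvp
        exact exp_ne_zero hvp.symm
      simp_all
    · refine exp_neg_one_mul_sq_ne_sq _ (Valued.v x₁) ((Valuation.ne_zero_iff Valued.v).mpr h₀) ?_
      rw [← hvp, ← map_pow, ← map_pow, ← map_mul, h']
  · obtain ⟨w, hw, hw'⟩ := valued_sq_sub_eq_sq ha (x₀ / x₂)
    refine exp_neg_one_mul_sq_ne_sq w (Valued.v (x₁ / x₂)) hw ?_
    rw [← hw', ← hvp, ← map_pow, ← map_mul]
    congr 1
    field_simp
    linear_combination -h

variable {v} in
theorem isSquare_algebraMap_adicCompletion {a : R} (h2 : 2 ∉ v.asIdeal) (ha : a - 1 ∈ v.asIdeal) :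
    IsSquare (algebraMap R (v.adicCompletion K) a) := by
  refine Valued.isSquare_of_v_sub_one_lt_one ?_ ?_
  · rwa [← map_ofNat (algebraMap R (v.adicCompletion K)) 2, valued_algebraMap_adicCompletion,
      intValuation_eq_one_iff]
  · rwa [← map_one (algebraMap R (v.adicCompletion K)), ← map_sub,
      valued_algebraMap_adicCompletion, intValuation_lt_one_iff_mem]

variable {v} in
lemma exists_not_isSquare_mk [Finite (R ⧸ v.asIdeal)] (h2 : 2 ∉ v.asIdeal) :
    ∃ r : R, ¬ IsSquare (Ideal.Quotient.mk v.asIdeal r) := by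
  have := v.isMaximal
  let := Ideal.Quotient.field v.asIdeal
  have hF : ringChar (R ⧸ v.asIdeal) ≠ 2 := by
    intro h
    have := ringChar.Nat.cast_ringChar (R := R ⧸ v.asIdeal)
    rw [h, ← map_natCast (Ideal.Quotient.mk v.asIdeal), Ideal.Quotient.eq_zero_iff_mem] at this
    exact h2 (by simpa using this)
  obtain ⟨y, hy⟩ := FiniteField.exists_nonsquare hF
  obtain ⟨r, rfl⟩ := Ideal.Quotient.mk_surjective y
  exact ⟨r, hy⟩

variable {v} in
lemma isCoprime_of_notMem {p x : R} (hv : v.asIdeal = Ideal.span {p}) (hx : x ∉ v.asIdeal) :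
    IsCoprime p x := by
  obtain ⟨y, i, hi, h⟩ := v.isMaximal.exists_inv hx
  rw [hv, Ideal.mem_span_singleton'] at hi
  obtain ⟨b, rfl⟩ := hi
  exact ⟨b, y, by rwa [add_comm]⟩

end IsDedekindDomain.HeightOneSpectrum

open NumberField IsDedekindDomain

/-- Let `p₁, p₂` be two odd prime elements of `𝓞 K` with distinct associated finite places
and let `I = p₁p₂𝓞 K`.  There exists `x ∈ 𝓞 K`, invertible mod `I`, such that for every
`a ≡ x mod I`: the conic `x₀² − p₁x₁² − a·x₂² = 0` has no nontrivial solution in `K_{v_{p₁}}`,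
while `x₀² − p₂x₁² − a·x₂² = 0` has a nontrivial solution in `K_{v_{p₂}}`. -/
theorem exists_residue_class_hilbert_symbols
    (K : Type*) [Field K] [NumberField K]
    (p₁ p₂ : 𝓞 K) (hp₁ : Prime p₁) (hp₂ : Prime p₂)
    (v₁ v₂ : HeightOneSpectrum (𝓞 K))
    (hv₁ : v₁.asIdeal = Ideal.span {p₁}) (hv₂ : v₂.asIdeal = Ideal.span {p₂})
    (hodd₁ : (2 : 𝓞 K) ∉ v₁.asIdeal) (hodd₂ : (2 : 𝓞 K) ∉ v₂.asIdeal)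
    (hne : v₁ ≠ v₂) :
    ∃ x : 𝓞 K, IsUnit (Ideal.Quotient.mk (Ideal.span {p₁ * p₂}) x) ∧
      ∀ a : 𝓞 K, a - x ∈ Ideal.span ({p₁ * p₂} : Set (𝓞 K)) →
        (¬ ∃ x₀ x₁ x₂ : v₁.adicCompletion K, ¬(x₀ = 0 ∧ x₁ = 0 ∧ x₂ = 0) ∧
            x₀ ^ 2 - algebraMap (𝓞 K) (v₁.adicCompletion K) p₁ * x₁ ^ 2
              - algebraMap (𝓞 K) (v₁.adicCompletion K) a * x₂ ^ 2 = 0) ∧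
        (∃ x₀ x₁ x₂ : v₂.adicCompletion K, ¬(x₀ = 0 ∧ x₁ = 0 ∧ x₂ = 0) ∧
            x₀ ^ 2 - algebraMap (𝓞 K) (v₂.adicCompletion K) p₂ * x₁ ^ 2
              - algebraMap (𝓞 K) (v₂.adicCompletion K) a * x₂ ^ 2 = 0) := by
  have hcop : IsCoprime v₁.asIdeal v₂.asIdeal := by
    have := v₁.isMaximal
    have := v₂.isMaximal
    exact Ideal.isCoprime_of_isMaximal fun h ↦ hne (HeightOneSpectrum.ext h)
  have := v₁.isMaximal
  obtain ⟨r, hr⟩ := HeightOneSpectrum.exists_not_isSquare_mk hodd₁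
  obtain ⟨e₁, he₁, e₂, he₂, he⟩ := Ideal.isCoprime_iff_exists.mp hcop
  set x := r * e₂ + e₁
  have hx₁ : x - r ∈ v₁.asIdeal := by
    have : x - r = (1 - r) * e₁ := by linear_combination r * he
    exact this ▸ Ideal.mul_mem_left _ _ he₁
  have hx₂ : x - 1 ∈ v₂.asIdeal := by
    have : x - 1 = (r - 1) * e₂ := by linear_combination he
    exact this ▸ Ideal.mul_mem_left _ _ he₂
  have hle₁ : Ideal.span {p₁ * p₂} ≤ v₁.asIdeal := by
    rw [hv₁, Ideal.span_singleton_le_span_singleton]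
    exact dvd_mul_right _ _
  have hle₂ : Ideal.span {p₁ * p₂} ≤ v₂.asIdeal := by
    rw [hv₂, Ideal.span_singleton_le_span_singleton]
    exact dvd_mul_left _ _
  refine ⟨x, ?_, fun a ha ↦ ⟨?_, ?_⟩⟩
  · have hxm₁ : x ∉ v₁.asIdeal := fun h ↦ hr <| by
      rw [← Ideal.Quotient.eq.mpr hx₁, Ideal.Quotient.eq_zero_iff_mem.mpr h]
      exact IsSquare.zero
    have hxm₂ : x ∉ v₂.asIdeal := fun h ↦ v₂.isPrime.one_notMem <| by
      simpa using sub_mem h hx₂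
    have hx : IsCoprime (p₁ * p₂) x :=
      (HeightOneSpectrum.isCoprime_of_notMem hv₁ hxm₁).mul_left
        (HeightOneSpectrum.isCoprime_of_notMem hv₂ hxm₂)
    obtain ⟨b, c, hbc⟩ := hx
    refine IsUnit.of_mul_eq_one (Ideal.Quotient.mk _ c) ?_
    rw [← map_mul, ← map_one (Ideal.Quotient.mk _), Ideal.Quotient.eq,
      Ideal.mem_span_singleton']
    exact ⟨-b, by linear_combination -hbc⟩
  · refine HeightOneSpectrum.not_exists_sq_sub_mul_sq_sub_mul_sq_eq_zero hp₁.ne_zero hv₁ ?_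
    have : Ideal.Quotient.mk v₁.asIdeal a = Ideal.Quotient.mk v₁.asIdeal r := by
      rw [Ideal.Quotient.eq, ← sub_add_sub_cancel a x r]
      exact add_mem (hle₁ ha) hx₁
    rwa [this]
  · obtain ⟨s, hs⟩ := HeightOneSpectrum.isSquare_algebraMap_adicCompletion (K := K) (a := a) hodd₂
      (by rw [← sub_add_sub_cancel a x 1]; exact add_mem (hle₂ ha) hx₂)
    replace hs : algebraMap (𝓞 K) (v₂.adicCompletion K) a = s * s := hs
    exact ⟨s, 0, 1, by simp, by linear_combination -hs⟩
end

section
/- Let p₁, p₂ ∈ 𝒪_K be two odd prime elements with v_{p₁} ≠ v_{p₂}. Assume that σ(p₁) > 0 for every real embedding σ : K → ℝ, that p₁ is a square in K_v for every finite place v of K above 2, and that p₂ is a square in K_{v_{p₁}}. Then p₁ is a square in K_{v_{p₂}}. -/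
open NumberField IsDedekindDomain

section Mean

variable {G H : Type*} [AddCommGroup G] [AddCommGroup H]

/-- The group of periods of a complex-valued function on an abelian group. -/
def periods (f : G → ℂ) : AddSubgroup G where
  carrier := {h | ∀ x, f (x + h) = f x}
  zero_mem' x := by rw [add_zero]
  add_mem' {a b} ha hb x := by rw [← add_assoc, hb, ha]
  neg_mem' {a} ha x := by rw [← ha (x + -a), neg_add_cancel_right]

theorem mem_periods {f : G → ℂ} {h : G} : h ∈ periods f ↔ ∀ x, f (x + h) = f x := Iff.rfl

/-- The mean of a function that factors through a finite quotient. -/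
noncomputable def periodicMean (f : G → ℂ) : ℂ :=
  (∑ᶠ a : G ⧸ periods f, f a.out) / Nat.card (G ⧸ periods f)

theorem apply_eq_of_sub_mem_periods {f : G → ℂ} {x y : G} (h : x - y ∈ periods f) : f x = f y := by
  simpa using h y

theorem apply_mk_out (f : G → ℂ) (x : G) : f (x : G ⧸ periods f).out = f x := by
  apply apply_eq_of_sub_mem_periods
  rw [← QuotientAddGroup.eq_iff_sub_mem]
  exact Quotient.out_eq _

theorem mem_periods_comp {f : H → ℂ} {φ : G →+ H} (hφ : ∀ y, ∃ x, φ x - y ∈ periods f) {h : G} :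
    h ∈ periods (f ∘ φ) ↔ φ h ∈ periods f := by
  constructor
  · intro hh y
    obtain ⟨x, hx⟩ := hφ y
    have h1 := hh x
    simp only [Function.comp_apply, map_add] at h1
    rw [← apply_eq_of_sub_mem_periods hx, ← h1]
    refine apply_eq_of_sub_mem_periods ?_
    convert neg_mem hx using 1
    abel
  · intro hh x
    simp only [Function.comp_apply, map_add]
    exact hh _

theorem periodicMean_comp {f : H → ℂ} (φ : G →+ H) (hφ : ∀ y, ∃ x, φ x - y ∈ periods f) :
    periodicMean (f ∘ φ) = periodicMean f := by
  let e : G ⧸ periods (f ∘ φ) →+ H ⧸ periods f :=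
    QuotientAddGroup.map _ _ φ fun h hh ↦ (mem_periods_comp hφ).1 hh
  have he : Function.Bijective e := by
    constructor
    · rw [injective_iff_map_eq_zero]
      intro a
      obtain ⟨x, rfl⟩ := QuotientAddGroup.mk_surjective a
      intro hx
      rw [QuotientAddGroup.eq_zero_iff, mem_periods_comp hφ]
      exact (QuotientAddGroup.eq_zero_iff _).1 hx
    · intro b
      obtain ⟨y, rfl⟩ := QuotientAddGroup.mk_surjective b
      obtain ⟨x, hx⟩ := hφ y
      exact ⟨x, (QuotientAddGroup.eq_iff_sub_mem).2 hx⟩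
  unfold periodicMean
  rw [Nat.card_congr (Equiv.ofBijective e he)]
  congr 1
  refine finsum_eq_of_bijective e he fun a ↦ ?_
  obtain ⟨x, rfl⟩ := QuotientAddGroup.mk_surjective a
  refine (apply_mk_out (f ∘ φ) x).trans ?_
  exact (apply_mk_out f (φ x)).symm

theorem periodicMean_eq_sum [Fintype G] (f : G → ℂ) :
    periodicMean f = (∑ x, f x) / Fintype.card G := by
  classical
  have hP : (Nat.card (periods f) : ℂ) ≠ 0 := by simp
  unfold periodicMean
  rw [finsum_eq_sum_of_fintype, ← Nat.card_eq_fintype_card,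
    (periods f).card_eq_card_quotient_mul_card_addSubgroup, Nat.cast_mul,
    ← mul_div_mul_right _ _ hP]
  congr 1
  rw [← (AddSubgroup.addGroupEquivQuotientProdAddSubgroup (s := periods f)).symm.sum_comp,
    Fintype.sum_prod_type, Finset.sum_mul]
  refine Finset.sum_congr rfl fun a _ ↦ ?_
  rw [Finset.sum_congr rfl (g := fun _ ↦ f a.out), Finset.sum_const, nsmul_eq_mul, mul_comm,
    Finset.card_univ, Nat.card_eq_fintype_card]
  intro p _
  refine (apply_mk_out f _).symm.trans (congrArg (fun a ↦ f (Quotient.out a)) ?_)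
  exact congrArg Prod.fst (AddSubgroup.addGroupEquivQuotientProdAddSubgroup.apply_symm_apply (a, p))

theorem periodicMean_eq_sum_of_surjective {A : Type*} [AddCommGroup A] [Fintype A] {f : G → ℂ}
    (π : G →+ A) (hπ : Function.Surjective π) (F : A → ℂ) (hF : ∀ x, f x = F (π x)) :
    periodicMean f = (∑ x, F x) / Fintype.card A := by
  obtain rfl : f = F ∘ π := funext hF
  rw [← periodicMean_eq_sum, periodicMean_comp]
  intro y
  obtain ⟨x, rfl⟩ := hπ y
  exact ⟨x, by simp⟩

theorem exists_quotient_factor (f : G → ℂ) :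
    ∃ (F : G ⧸ periods f → ℂ), ∀ x : G, f x = F x :=
  ⟨fun a ↦ f a.out, fun x ↦ (apply_mk_out f x).symm⟩

theorem periodicMean_prod {f : G → ℂ} {g : H → ℂ} (hf : (periods f).FiniteIndex)
    (hg : (periods g).FiniteIndex) :
    periodicMean (fun x : G × H ↦ f x.1 * g x.2) = periodicMean f * periodicMean g := by
  classical
  have := Fintype.ofFinite (G ⧸ periods f)
  have := Fintype.ofFinite (H ⧸ periods g)
  obtain ⟨F, hF⟩ := exists_quotient_factor f
  obtain ⟨F', hF'⟩ := exists_quotient_factor g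
  rw [periodicMean_eq_sum_of_surjective (QuotientAddGroup.mk' (periods f))
      (QuotientAddGroup.mk'_surjective _) F hF,
    periodicMean_eq_sum_of_surjective (QuotientAddGroup.mk' (periods g))
      (QuotientAddGroup.mk'_surjective _) F' hF',
    periodicMean_eq_sum_of_surjective
      ((QuotientAddGroup.mk' (periods f)).prodMap (QuotientAddGroup.mk' (periods g)))
      (Function.Surjective.prodMap (QuotientAddGroup.mk'_surjective _)
        (QuotientAddGroup.mk'_surjective _)) (fun x ↦ F x.1 * F' x.2)
      (fun x ↦ by rw [hF, hF']; rfl),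
    Fintype.sum_prod_type, div_mul_div_comm, Fintype.sum_mul_sum, Fintype.card_prod, Nat.cast_mul]

theorem periodicMean_pi {ι : Type*} [Fintype ι] {f : ι → G → ℂ}
    (hf : ∀ i, (periods (f i)).FiniteIndex) :
    periodicMean (fun x : ι → G ↦ ∏ i, f i (x i)) = ∏ i, periodicMean (f i) := by
  classical
  have := fun i ↦ Fintype.ofFinite (G ⧸ periods (f i))
  choose F hF using fun i ↦ exists_quotient_factor (f i)
  rw [Finset.prod_congr rfl fun i _ ↦ periodicMean_eq_sum_of_surjective
      (QuotientAddGroup.mk' (periods (f i))) (QuotientAddGroup.mk'_surjective _) (F i) (hF i),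
    periodicMean_eq_sum_of_surjective (A := ∀ i, G ⧸ periods (f i))
      (AddMonoidHom.pi fun i ↦ (QuotientAddGroup.mk' (periods (f i))).comp
        (Pi.evalAddMonoidHom _ i)) ?_ (fun x ↦ ∏ i, F i (x i)) ?_, Finset.prod_div_distrib,
    Finset.prod_univ_sum, Fintype.piFinset_univ, Fintype.card_pi, Nat.cast_prod]
  · intro y
    choose x hx using fun i ↦ QuotientAddGroup.mk_surjective (y i)
    exact ⟨x, funext hx⟩
  · intro x
    exact Finset.prod_congr rfl fun i _ ↦ hF i _

theorem finiteIndex_periods_of_nsmul [AddGroup.FG G] {f : G → ℂ} {N : ℕ} (hN : N ≠ 0)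
    (hf : ∀ x y, f (x + N • y) = f x) : (periods f).FiniteIndex := by
  have : Finite (G ⧸ periods f) := by
    refine AddCommGroup.finite_of_fg_isAddTorsion _ fun a ↦ ?_
    obtain ⟨x, rfl⟩ := QuotientAddGroup.mk_surjective a
    rw [isOfFinAddOrder_iff_nsmul_eq_zero]
    exact ⟨N, Nat.pos_of_ne_zero hN, (QuotientAddGroup.eq_zero_iff (N • x)).2 fun y ↦ hf y x⟩
  exact AddSubgroup.finiteIndex_of_finite_quotient

/-- If `f (x + y) = f x * χ x y` for `y ∈ Y`, where `χ x` is a character of `Y`, then the mean of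
`f` is a positive multiple of its mean over the subgroup where `χ x` is trivial. -/
theorem periodicMean_restrict {f : G → ℂ} (hf : (periods f).FiniteIndex) (hf0 : ∀ x, f x ≠ 0)
    (Y Z : AddSubgroup G) (χ : G → G → ℂ) (hχ : ∀ x, ∀ y ∈ Y, f (x + y) = f x * χ x y)
    (hχ' : ∀ x, ∀ y ∈ Y, ∀ y' ∈ Y, χ x (y + y') = χ x y * χ x y')
    (hZ : ∀ x, x ∈ Z ↔ ∀ y ∈ Y, χ x y = 1) :
    ∃ r : ℝ, 0 < r ∧ periodicMean f = r * periodicMean (f ∘ Z.subtype) := by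
  classical
  obtain ⟨F, hF⟩ := exists_quotient_factor f
  set π := QuotientAddGroup.mk' (periods f) with hπ
  have hπs : Function.Surjective π := QuotientAddGroup.mk'_surjective _
  replace hF : ∀ x, f x = F (π x) := hF
  have := Fintype.ofFinite (G ⧸ periods f)
  have hZP : ∀ x, π x ∈ Z.map π ↔ x ∈ Z := by
    refine fun x ↦ ⟨?_, fun h ↦ ⟨x, h, rfl⟩⟩
    rintro ⟨z, hz, hzx⟩
    have hp : x - z ∈ periods f := (QuotientAddGroup.eq_iff_sub_mem).1 hzx.symm
    rw [hZ]
    intro y hy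
    have h1 := hχ x y hy
    have h2 : f (x + y) = f (z + y) := apply_eq_of_sub_mem_periods (by simpa using hp)
    rw [h2, hχ z y hy, (hZ z).1 hz y hy, apply_eq_of_sub_mem_periods hp, mul_one] at h1
    exact mul_left_cancel₀ (hf0 z) (by rw [← h1, mul_one])
  have hinner : ∀ a, ∑ y : Y.map π, F (a + y) =
      if a ∈ Z.map π then Fintype.card (Y.map π) * F a else 0 := by
    intro a
    obtain ⟨x, rfl⟩ := hπs a
    split_ifs with h
    · rw [hZP, hZ] at h
      rw [Finset.sum_congr rfl (g := fun _ ↦ F (π x)), Finset.sum_const, nsmul_eq_mul,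
        Finset.card_univ]
      rintro ⟨_, y, hy, rfl⟩ _
      rw [← map_add, ← hF, ← hF, hχ x y hy, h y hy, mul_one]
    · rw [hZP, hZ] at h
      push Not at h
      obtain ⟨y₀, hy₀, h1⟩ := h
      let y₁ : Y.map π := ⟨π y₀, y₀, hy₀, rfl⟩
      have key : ∑ y : Y.map π, F (π x + y) = χ x y₀ * ∑ y : Y.map π, F (π x + y) := by
        refine (Equiv.sum_comp (Equiv.addRight y₁) _).symm.trans ?_
        rw [Finset.mul_sum]
        refine Finset.sum_congr rfl ?_
        rintro ⟨_, y, hy, rfl⟩ _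
        have : π x + ((Equiv.addRight y₁) ⟨π y, y, hy, rfl⟩ : Y.map π) = π (x + (y + y₀)) := by
          simp [y₁]
        rw [this, ← map_add π x y, ← hF, ← hF, hχ x y hy, hχ x _ (add_mem hy hy₀),
          hχ' x y hy y₀ hy₀]
        ring
      have : (1 - χ x y₀) * ∑ y : Y.map π, F (π x + y) = 0 := by linear_combination key
      exact (mul_eq_zero.1 this).resolve_left (sub_ne_zero.2 (Ne.symm h1))
  have hcY : (Fintype.card (Y.map π) : ℂ) ≠ 0 := Nat.cast_ne_zero.2 Fintype.card_ne_zero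
  have hsum : ∑ a, F a = ∑ a : Z.map π, F a := by
    apply mul_left_cancel₀ hcY
    calc (Fintype.card (Y.map π) : ℂ) * ∑ a, F a = ∑ y : Y.map π, ∑ a, F (a + y) := by
          have (y : Y.map π) : ∑ a, F (a + y) = ∑ a, F a :=
            Equiv.sum_comp (Equiv.addRight (y : G ⧸ periods f)) F
          simp_rw [this, Finset.sum_const, Finset.card_univ, nsmul_eq_mul]
      _ = ∑ a, if a ∈ Z.map π then Fintype.card (Y.map π) * F a else 0 := by
          rw [Finset.sum_comm]
          exact Finset.sum_congr rfl fun a _ ↦ hinner a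
      _ = _ := by
          rw [← Finset.sum_filter, Finset.mul_sum]
          exact Finset.sum_subtype _ (by simp) _
  have hmZ : periodicMean (f ∘ Z.subtype) = (∑ a : Z.map π, F a) / Fintype.card (Z.map π) := by
    refine periodicMean_eq_sum_of_surjective (π.addSubgroupMap Z)
      (π.addSubgroupMap_surjective Z) (fun a ↦ F a) fun x ↦ ?_
    exact hF _
  have hcZ : 0 < Fintype.card (Z.map π) := Fintype.card_pos
  have hcA : 0 < Fintype.card (G ⧸ periods f) := Fintype.card_pos
  refine ⟨Fintype.card (Z.map π) / Fintype.card (G ⧸ periods f), by positivity, ?_⟩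
  rw [periodicMean_eq_sum_of_surjective π hπs F hF, hmZ, hsum]
  have : (Fintype.card (Z.map π) : ℂ) ≠ 0 := Nat.cast_ne_zero.2 hcZ.ne'
  push_cast
  field_simp

end Mean

section OneDim

open Complex Filter Topology Asymptotics

theorem periodicMean_int {f : ℤ → ℂ} {N : ℕ} [NeZero N] (hf : ∀ k, f (k + N) = f k) :
    periodicMean f = (∑ a : ZMod N, f a.val) / N := by
  have h : (N : ℤ) ∈ periods f := hf
  rw [periodicMean_eq_sum_of_surjective (Int.castAddHom (ZMod N)) ZMod.intCast_surjective
    (fun a ↦ f a.val), ZMod.card]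
  intro k
  apply apply_eq_of_sub_mem_periods
  have : k - ((k : ZMod N).val : ℤ) = (k / N) • (N : ℤ) := by
    rw [ZMod.val_intCast, smul_eq_mul]
    linarith [Int.emod_add_mul_ediv k N]
  exact this ▸ zsmul_mem h (k / N)

theorem hasSum_mul_gaussian {f : ℤ → ℂ} {N : ℕ} [NeZero N] (hf : ∀ k, f (k + N) = f k) {t : ℝ}
    (ht : 0 < t) :
    HasSum (fun n : ℤ ↦ f n * Real.exp (-Real.pi * n ^ 2 * t))
      (∑ a : ZMod N, f a.val * HurwitzZeta.evenKernel ((a.val / N : ℝ)) (N ^ 2 * t)) := by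
  classical
  have hN : (N : ℝ) ≠ 0 := NeZero.ne _
  have h : (N : ℤ) ∈ periods f := hf
  have key (a : ZMod N) : HasSum
      (fun n : ℤ ↦ if (n : ZMod N) = a then f n * (Real.exp (-Real.pi * n ^ 2 * t) : ℂ) else 0)
      (f a.val * HurwitzZeta.evenKernel ((a.val / N : ℝ)) (N ^ 2 * t)) := by
    have hinj : Function.Injective (fun m : ℤ ↦ (a.val : ℤ) + m * N) := by
      intro m m' hm
      simpa [NeZero.ne N] using hm
    rw [← hinj.hasSum_iff]
    · have h1 := (HurwitzZeta.hasSum_int_evenKernel (a.val / N) (t := N ^ 2 * t) (by positivity))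
      convert! (hasSum_ofReal.2 h1).mul_left (f a.val) using 2 with m
      have h2 : (((a.val : ℤ) + m * N : ℤ) : ZMod N) = a := by simp
      rw [Function.comp_apply, if_pos h2]
      congr 1
      · apply apply_eq_of_sub_mem_periods
        simpa using zsmul_mem h m
      · congr 2
        push_cast
        field_simp
        ring
    · intro n hn
      rw [if_neg]
      rintro rfl
      refine hn ⟨n / N, ?_⟩
      simp only [ZMod.val_intCast]
      linarith [Int.emod_add_mul_ediv n N]
  convert! hasSum_sum fun a (_ : a ∈ Finset.univ) ↦ key a using 2 with n
  simp

theorem tendsto_sqrt_mul_evenKernel (x : UnitAddCircle) {N : ℕ} [NeZero N] :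
    Tendsto (fun t : ℝ ↦ √t * HurwitzZeta.evenKernel x (N ^ 2 * t)) (𝓝[>] 0) (𝓝 (1 / N)) := by
  have hN : 0 < (N : ℝ) := Nat.cast_pos.2 (NeZero.pos N)
  obtain ⟨p, hp, h⟩ := HurwitzZeta.isBigO_atTop_cosKernel_sub x
  have h1 : Tendsto (HurwitzZeta.cosKernel x) atTop (𝓝 1) := by
    have := h.trans_tendsto (Real.tendsto_exp_atBot.comp
      (tendsto_id.const_mul_atTop_of_neg (neg_neg_of_pos hp)))
    simpa using this.add_const 1
  have h2 : Tendsto (fun t : ℝ ↦ 1 / (N ^ 2 * t)) (𝓝[>] 0) atTop := by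
    simp_rw [one_div, mul_inv]
    exact tendsto_inv_nhdsGT_zero.const_mul_atTop (by positivity)
  have h3 := (h1.comp h2).const_mul (1 / N : ℝ)
  rw [mul_one] at h3
  refine h3.congr' ?_
  filter_upwards [self_mem_nhdsWithin] with t (ht : 0 < t)
  rw [HurwitzZeta.evenKernel_functional_equation, ← Real.sqrt_eq_rpow,
    Real.sqrt_mul (by positivity),
    Real.sqrt_sq hN.le, Function.comp_apply]
  have := Real.sqrt_pos.2 ht
  field_simp

theorem tendsto_sqrt_mul_tsum {f : ℤ → ℂ} {N : ℕ} [NeZero N] (hf : ∀ k, f (k + N) = f k) :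
    Tendsto (fun t : ℝ ↦ √t * ∑' n : ℤ, f n * (Real.exp (-Real.pi * n ^ 2 * t) : ℂ)) (𝓝[>] 0)
      (𝓝 (periodicMean f)) := by
  have h : Tendsto (fun t : ℝ ↦ ∑ a : ZMod N, f a.val *
      ((√t * HurwitzZeta.evenKernel ((a.val / N : ℝ)) (N ^ 2 * t) : ℝ) : ℂ)) (𝓝[>] 0)
      (𝓝 (∑ a : ZMod N, f a.val * ((1 / N : ℝ) : ℂ))) :=
    tendsto_finsetSum _ fun a _ ↦
      ((continuous_ofReal.tendsto _).comp (tendsto_sqrt_mul_evenKernel _)).const_mul _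
  have h1 : periodicMean f = ∑ a : ZMod N, f a.val * ((1 / N : ℝ) : ℂ) := by
    rw [periodicMean_int hf, ← Finset.sum_mul]
    simp [div_eq_mul_inv]
  rw [h1]
  refine h.congr' ?_
  filter_upwards [self_mem_nhdsWithin] with t (ht : 0 < t)
  rw [(hasSum_mul_gaussian hf ht).tsum_eq, Finset.mul_sum]
  refine Finset.sum_congr rfl fun a _ ↦ ?_
  push_cast
  ring

theorem ofReal_mul_cpow {r : ℝ} (hr : 0 < r) {z : ℂ} (hz : z ≠ 0) (s : ℂ) :
    (r * z) ^ s = r ^ s * z ^ s := by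
  have hr' : (r : ℂ) ≠ 0 := ofReal_ne_zero.2 hr.ne'
  rw [cpow_def_of_ne_zero (mul_ne_zero hr' hz), cpow_def_of_ne_zero hr', cpow_def_of_ne_zero hz,
    log_ofReal_mul hr hz, add_mul, exp_add, ofReal_log hr.le]

theorem ofReal_cpow_half {r : ℝ} (hr : 0 < r) : (r : ℂ) ^ (1 / 2 : ℂ) = (√r : ℝ) := by
  rw [Real.sqrt_eq_rpow, ofReal_cpow hr.le]
  norm_num

theorem neg_I_cpow_half : (-I) ^ (1 / 2 : ℂ) = ((√2 / 2 : ℝ) : ℂ) * (1 - I) := by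
  have : -(Real.pi / 2 : ℂ) * I * (1 / 2) = ((-(Real.pi / 4) : ℝ) : ℂ) * I := by push_cast; ring
  rw [cpow_def_of_ne_zero (neg_ne_zero.2 I_ne_zero), log_neg_I, this, exp_mul_I,
    ← ofReal_cos, ← ofReal_sin, Real.cos_neg, Real.sin_neg, Real.cos_pi_div_four,
    Real.sin_pi_div_four]
  push_cast
  ring

theorem jacobiTheta_neg_inv {τ : ℂ} (hτ : 0 < τ.im) :
    jacobiTheta (-1 / τ) = (-I * τ) ^ (1 / 2 : ℂ) * jacobiTheta τ := by
  have := jacobiTheta_S_smul ⟨τ, hτ⟩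
  rw [UpperHalfPlane.modular_S_smul] at this
  convert this using 2
  simp [neg_div, inv_neg]

theorem tendsto_jacobiTheta {l : Filter ℝ} {g : ℝ → ℂ} (hg : Tendsto (fun t ↦ (g t).im) l atTop) :
    Tendsto (fun t ↦ jacobiTheta (g t)) l (𝓝 1) := by
  have h := isBigO_at_im_infty_jacobiTheta_sub_one.trans_tendsto (g'' := _)
    (Real.tendsto_exp_atBot.comp
      (tendsto_comap.const_mul_atTop_of_neg (neg_neg_of_pos Real.pi_pos)))
  have := (h.comp (tendsto_comap_iff.2 hg)).add_const 1
  simpa [Function.comp_def] using this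

theorem jacobiTheta_add_two_mul (τ : ℂ) (n : ℕ) : jacobiTheta (τ + 2 * n) = jacobiTheta τ := by
  induction n with
  | zero => simp
  | succ n ih =>
    rw [← ih, ← jacobiTheta_two_add (τ + 2 * n)]
    congr 1
    push_cast
    ring


theorem cexp_quarter_add {a : ℤ} (ha : a ≠ 0) (k m : ℤ) :
    cexp (2 * Real.pi * I * ((k + 4 * a * m : ℤ) ^ 2 / (4 * a))) =
      cexp (2 * Real.pi * I * (k ^ 2 / (4 * a))) := by
  rw [exp_eq_exp_iff_exists_int]
  refine ⟨2 * k * m + 4 * a * m ^ 2, ?_⟩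
  have : (a : ℂ) ≠ 0 := Int.cast_ne_zero.2 ha
  push_cast
  field_simp
  ring

theorem periodicMean_gauss_of_pos {a : ℕ} (ha : 0 < a) :
    ∃ r : ℝ, 0 < r ∧ periodicMean (fun k : ℤ ↦ cexp (2 * Real.pi * I * (k ^ 2 / (4 * (a : ℤ))))) =
      r * (1 + I) := by
  set f : ℤ → ℂ := fun k : ℤ ↦ cexp (2 * Real.pi * I * (k ^ 2 / (4 * (a : ℤ)))) with hf
  have : NeZero a := ⟨ha.ne'⟩
  have ha' : (0 : ℝ) < a := Nat.cast_pos.2 ha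
  have haC : (a : ℂ) ≠ 0 := Nat.cast_ne_zero.2 ha.ne'
  have hper : ∀ k, f (k + (4 * a : ℕ)) = f k := fun k ↦ by
    have := cexp_quarter_add (Int.natCast_ne_zero.2 ha.ne') k 1
    simpa [hf] using this
  have hlim := tendsto_sqrt_mul_tsum hper
  let τ : ℝ → ℂ := fun t ↦ 1 / (2 * a) + I * t
  let w : ℝ → ℂ := fun t ↦ (1 + 2 * a * I * t)⁻¹
  have hτim (t : ℝ) : (τ t).im = t := by
    simp only [τ, add_im, mul_im, I_re, I_im, ofReal_re, ofReal_im]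
    rw [show (1 / (2 * a) : ℂ) = ((1 / (2 * a) : ℝ) : ℂ) by push_cast; rfl, ofReal_im]
    ring
  have hw0 (t : ℝ) : 1 + 2 * a * I * (t : ℂ) ≠ 0 := by
    intro h
    have := congrArg re h
    simp at this
  have hsum (t : ℝ) : ∑' n : ℤ, f n * (Real.exp (-Real.pi * n ^ 2 * t) : ℂ) =
      jacobiTheta (τ t) := by
    refine tsum_congr fun n ↦ ?_
    simp only [hf, τ]
    rw [ofReal_exp, ← Complex.exp_add]
    congr 1
    push_cast
    field_simp
    linear_combination (-8 * a * t * n ^ 2 : ℂ) * I_sq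
  simp_rw [hsum] at hlim
  let g : ℝ → ℂ := fun t ↦ I * ((1 / (4 * a ^ 2 * t) : ℝ) : ℂ) - ((1 / (2 * a) : ℝ) : ℂ)
  have hgim (t : ℝ) : (g t).im = 1 / (4 * a ^ 2) * t⁻¹ := by
    simp only [g, sub_im, mul_im, I_re, I_im, ofReal_re, ofReal_im]
    field_simp
    ring
  have hg1 : Tendsto (fun t ↦ jacobiTheta (g t)) (𝓝[>] 0) (𝓝 1) := by
    refine tendsto_jacobiTheta ?_
    simp_rw [hgim]
    exact tendsto_inv_nhdsGT_zero.const_mul_atTop (by positivity)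
  have hg2 (t : ℝ) (ht : 0 < t) : jacobiTheta (g t) =
      2 * a * w t ^ (1 / 2 : ℂ) * (-I * τ t) ^ (1 / 2 : ℂ) * (√t * jacobiTheta (τ t)) := by
    have htC : (t : ℂ) ≠ 0 := ofReal_ne_zero.2 ht.ne'
    have hτ0 : τ t ≠ 0 := by
      intro h
      have := hτim t
      rw [h, zero_im] at this
      exact ht.ne this
    have hτ' : -1 / τ t + 2 * a = 4 * a ^ 2 * t * I * w t := by
      have h1 : τ t = (1 + 2 * a * I * t) / (2 * a) := by
        simp only [τ]
        field_simp
      have := hw0 t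
      simp only [w]
      rw [h1]
      field_simp
      ring
    have hz : g t = -1 / (4 * a ^ 2 * t * I * w t) := by
      have := hw0 t
      simp only [g, w]
      push_cast
      field_simp
      linear_combination (2 : ℂ) * I_sq
    have hzim : 0 < (4 * a ^ 2 * t * I * w t : ℂ).im := by
      rw [← hτ', add_im, neg_div, neg_im, one_div, inv_im, hτim, mul_im]
      simp only [re_ofNat, natCast_im, im_ofNat, mul_zero, natCast_re, zero_mul, add_zero]
      rw [neg_div, neg_neg]
      exact div_pos ht (normSq_pos.2 hτ0)
    rw [hz, jacobiTheta_neg_inv hzim, ← hτ', jacobiTheta_add_two_mul,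
      jacobiTheta_neg_inv (by rwa [hτim]), hτ']
    have h2 : -I * (4 * a ^ 2 * t * I * w t) = ((4 * a ^ 2 * t : ℝ) : ℂ) * w t := by
      push_cast
      linear_combination (-4 * a ^ 2 * t * w t) * I_sq
    rw [h2, ofReal_mul_cpow (by positivity) (inv_ne_zero (hw0 t)), ofReal_cpow_half (by positivity),
      Real.sqrt_mul (by positivity), show (4 * a ^ 2 : ℝ) = (2 * a) ^ 2 by ring,
      Real.sqrt_sq (by positivity)]
    push_cast
    ring
  have hτlim : Tendsto (fun t ↦ (-I * τ t) ^ (1 / 2 : ℂ)) (𝓝[>] 0)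
      (𝓝 ((((1 / (2 * a) : ℝ) : ℂ) * -I) ^ (1 / 2 : ℂ))) := by
    have h1 : Tendsto (fun t ↦ -I * τ t) (𝓝[>] 0) (𝓝 (((1 / (2 * a) : ℝ) : ℂ) * -I)) := by
      have : Continuous (fun t ↦ -I * τ t) := by fun_prop
      have h := (this.tendsto 0).mono_left (nhdsWithin_le_nhds (s := Set.Ioi 0))
      convert h using 2
      simp only [τ]
      push_cast
      ring
    refine h1.cpow tendsto_const_nhds (Or.inr ?_)
    rw [im_ofReal_mul]
    simpa using ha.ne'
  have hwlim : Tendsto (fun t ↦ w t ^ (1 / 2 : ℂ)) (𝓝[>] 0) (𝓝 1) := by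
    have h1 : Tendsto w (𝓝[>] 0) (𝓝 1) := by
      have h0 : Continuous (fun t : ℝ ↦ 1 + 2 * a * I * (t : ℂ)) := by fun_prop
      have : Continuous w := h0.inv₀ hw0
      have h := (this.tendsto 0).mono_left (nhdsWithin_le_nhds (s := Set.Ioi 0))
      convert h using 2
      simp [w]
    have := h1.cpow (tendsto_const_nhds (x := (1 / 2 : ℂ))) (Or.inl (by simp))
    simpa using this
  have hfin := tendsto_nhds_unique hg1 ((((hwlim.const_mul (2 * a : ℂ)).mul hτlim).mul hlim).congr'
    (by filter_upwards [self_mem_nhdsWithin] with t ht using (hg2 t ht).symm))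
  have hr : (0 : ℝ) < 1 / (2 * a) := by positivity
  rw [ofReal_mul_cpow hr (neg_ne_zero.2 I_ne_zero), ofReal_cpow_half hr, neg_I_cpow_half] at hfin
  have hs : 0 < √(1 / (2 * a) : ℝ) := Real.sqrt_pos.2 hr
  refine ⟨1 / (2 * a * √(1 / (2 * a) : ℝ) * √2), by positivity, ?_⟩
  have hsC : ((√(1 / (2 * a) : ℝ) : ℝ) : ℂ) ≠ 0 := ofReal_ne_zero.2 hs.ne'
  have h2C : ((√2 : ℝ) : ℂ) ≠ 0 := ofReal_ne_zero.2 (by positivity)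
  generalize √(1 / (2 * a) : ℝ) = s at hfin hsC
  generalize √2 = q at hfin h2C
  push_cast at hfin ⊢
  field_simp
  linear_combination (-(1 + I)) * hfin + (a * q * s * periodicMean f) * I_sq

/-- The phase of a Gauss sum, up to a positive real factor. -/
noncomputable def gaussPhase (s : SignType) : ℂ := 1 + s * I

theorem gaussPhase_ne_zero (s : SignType) : gaussPhase s ≠ 0 := by
  intro h
  have h1 := congrArg re h
  have h2 := congrArg im h
  cases s <;> simp [gaussPhase] at h1 h2

theorem periodicMean_gauss {a : ℤ} (ha : a ≠ 0) :
    ∃ r : ℝ, 0 < r ∧ periodicMean (fun k : ℤ ↦ cexp (2 * Real.pi * I * (k ^ 2 / (4 * a)))) =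
      r * gaussPhase (SignType.sign a) := by
  rcases lt_or_gt_of_ne ha with h | h
  · obtain ⟨b, rfl⟩ : ∃ b : ℕ, a = -b := ⟨a.natAbs, by omega⟩
    have hb : 0 < b := by omega
    obtain ⟨r, hr, hr'⟩ := periodicMean_gauss_of_pos hb
    refine ⟨r, hr, ?_⟩
    have hper (s : ℤ) (hs : s ^ 2 = 1) (k : ℤ) :
        cexp (2 * Real.pi * I * ((k + (4 * b : ℕ) : ℤ) ^ 2 / (4 * (s * b : ℤ)))) =
          cexp (2 * Real.pi * I * (k ^ 2 / (4 * (s * b : ℤ)))) := by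
      have hs0 : s ≠ 0 := by rintro rfl; simp at hs
      rw [← cexp_quarter_add (mul_ne_zero hs0 (Int.natCast_ne_zero.2 hb.ne')) k s]
      congr 5
      push_cast
      linear_combination (-4 * b : ℤ) * hs
    have : NeZero b := ⟨hb.ne'⟩
    have h1 := hper 1 (by norm_num)
    have h2 := hper (-1) (by norm_num)
    simp only [one_mul, neg_one_mul] at h1 h2
    rw [periodicMean_int (N := 4 * b) h1] at hr'
    rw [periodicMean_int (N := 4 * b) h2]
    have h3 := congrArg (starRingEnd ℂ) hr'
    rw [map_div₀, map_sum, map_mul, conj_ofReal, map_natCast] at h3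
    convert h3 using 1
    · congr 1
      refine Finset.sum_congr rfl fun x _ ↦ ?_
      rw [← exp_conj]
      congr 1
      simp only [map_mul, map_div₀, map_pow, conj_ofReal, conj_I, map_ofNat, map_intCast]
      push_cast
      rw [mul_neg, div_neg]
      ring
    · simp [gaussPhase, sign_neg h]
  · obtain ⟨b, rfl⟩ : ∃ b : ℕ, a = b := ⟨a.natAbs, by omega⟩
    have hb : 0 < b := by omega
    obtain ⟨r, hr, hr'⟩ := periodicMean_gauss_of_pos hb
    refine ⟨r, hr, hr'.trans ?_⟩
    simp [gaussPhase, sign_pos h]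

end OneDim

section Milgram

/-- The standard additive character of `ℚ` with kernel `ℤ`. -/
noncomputable def ratExp (q : ℚ) : ℂ := Complex.exp (2 * Real.pi * Complex.I * q)

theorem ratExp_add (q r : ℚ) : ratExp (q + r) = ratExp q * ratExp r := by
  rw [ratExp, ratExp, ratExp, ← Complex.exp_add]
  push_cast
  ring_nf

theorem ratExp_sum {ι : Type*} (s : Finset ι) (q : ι → ℚ) :
    ratExp (∑ i ∈ s, q i) = ∏ i ∈ s, ratExp (q i) := by
  simp only [ratExp]
  rw [← Complex.exp_sum]
  push_cast
  rw [Finset.mul_sum]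

theorem ratExp_ne_zero (q : ℚ) : ratExp q ≠ 0 := Complex.exp_ne_zero _

theorem ratExp_eq_one_iff {q : ℚ} : ratExp q = 1 ↔ ∃ n : ℤ, q = n := by
  rw [ratExp, Complex.exp_eq_one_iff]
  refine exists_congr fun n ↦ ?_
  rw [mul_comm _ (q : ℂ), mul_left_inj' Complex.two_pi_I_ne_zero]
  norm_cast

theorem ratExp_intCast (n : ℤ) : ratExp n = 1 := ratExp_eq_one_iff.2 ⟨n, rfl⟩

theorem ratExp_add_intCast (q : ℚ) (n : ℤ) : ratExp (q + n) = ratExp q := by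
  rw [ratExp_add, ratExp_intCast, mul_one]

theorem ratExp_gauss_add {a : ℤ} (ha : a ≠ 0) (k m : ℤ) :
    ratExp ((k + 4 * a * m : ℤ) ^ 2 / (4 * a)) = ratExp (k ^ 2 / (4 * a)) := by
  simpa [ratExp] using cexp_quarter_add ha k m

theorem periodicMean_ratExp_gauss {a : ℤ} (ha : a ≠ 0) :
    ∃ r : ℝ, 0 < r ∧ periodicMean (fun k : ℤ ↦ ratExp (k ^ 2 / (4 * a))) =
      r * gaussPhase (SignType.sign a) := by
  simpa [ratExp] using periodicMean_gauss ha

variable {V ι : Type*} [AddCommGroup V] [Module ℚ V] [Fintype ι]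

theorem two_mul_apply_eq_intCast {B : LinearMap.BilinForm ℚ V} (hB : B.IsSymm) {L : AddSubgroup V}
    (hint : ∀ x ∈ L, ∃ n : ℤ, B x x = n) {x y : V} (hx : x ∈ L) (hy : y ∈ L) :
    ∃ n : ℤ, 2 * B x y = n := by
  obtain ⟨a, ha⟩ := hint _ hx
  obtain ⟨b, hb⟩ := hint _ hy
  obtain ⟨c, hc⟩ := hint _ (add_mem hx hy)
  refine ⟨c - a - b, ?_⟩
  simp only [map_add, LinearMap.add_apply] at hc
  push_cast
  rw [← hc, ← ha, ← hb, hB.eq x y]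
  ring

theorem exists_periodicMean_dual_aux {B : LinearMap.BilinForm ℚ V} (hB : B.IsSymm)
    {L Λ : AddSubgroup V} (hint : ∀ x ∈ L, ∃ n : ℤ, B x x = n)
    (hΛ : ∀ x, x ∈ Λ ↔ ∀ y ∈ L, ∃ n : ℤ, 2 * B x y = n) (e : Module.Basis ι ℚ V)
    (he : ∀ i j, i ≠ j → B (e i) (e j) = 0) (he0 : ∀ i, B (e i) (e i) ≠ 0) (heL : ∀ i, e i ∈ L) :
    ∃ r : ℝ, 0 < r ∧ periodicMean (fun x : Λ ↦ ratExp (B x x)) =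
      r * ∏ i, gaussPhase (SignType.sign (B (e i) (e i))) := by
  classical
  choose a ha using fun i ↦ hint _ (heL i)
  have ha0 (i) : a i ≠ 0 := by
    have := he0 i
    rw [ha] at this
    exact_mod_cast this
  have ha0' (i) : (a i : ℚ) ≠ 0 := Int.cast_ne_zero.2 (ha0 i)
  let φ : (ι → ℤ) →+ V :=
    { toFun := fun k ↦ ∑ i, (k i / (2 * a i) : ℚ) • e i
      map_zero' := by simp
      map_add' := fun k l ↦ by
        simp only [Pi.add_apply, Int.cast_add, add_div, add_smul, Finset.sum_add_distrib] }
  have hφe (k : ι → ℤ) (i : ι) : 2 * B (φ k) (e i) = k i := by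
    change 2 * B (∑ i, (k i / (2 * a i) : ℚ) • e i) (e i) = k i
    rw [map_sum, LinearMap.sum_apply, Finset.sum_eq_single i]
    · have := ha0' i
      simp only [map_smul, LinearMap.smul_apply, ha, smul_eq_mul]
      field_simp
    · intro j _ hji
      simp [he j i hji]
    · simp
  have hφQ (k : ι → ℤ) : B (φ k) (φ k) = ∑ i, (k i : ℚ) ^ 2 / (4 * a i) := by
    conv_lhs => enter [2]; change ∑ i, (k i / (2 * a i) : ℚ) • e i
    rw [map_sum]
    refine Finset.sum_congr rfl fun i _ ↦ ?_
    rw [map_smul, smul_eq_mul]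
    have := ha0' i
    have := hφe k i
    field_simp
    linear_combination 2 * k i * this
  have hφs {x : V} (hx : ∀ i, ∃ n : ℤ, 2 * B x (e i) = n) : ∃ k, φ k = x := by
    choose k hk using hx
    have hnd : ∀ z, (∀ i, B z (e i) = 0) → z = 0 := by
      intro z hz
      apply e.ext_elem
      intro i
      have h1 := hz i
      rw [← e.sum_repr z, map_sum, LinearMap.sum_apply, Finset.sum_eq_single i] at h1
      · simpa [he0 i] using h1
      · intro j _ hji
        simp [he j i hji]
      · simp
    refine ⟨k, sub_eq_zero.1 (hnd _ fun i ↦ ?_)⟩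
    rw [map_sub, LinearMap.sub_apply]
    linear_combination (hφe k i - hk i) / 2
  set f : (ι → ℤ) → ℂ := fun k ↦ ratExp (B (φ k) (φ k)) with hf
  have hfprod : f = fun k ↦ ∏ i, ratExp ((k i : ℚ) ^ 2 / (4 * a i)) := by
    funext k
    rw [hf]
    simp only
    rw [hφQ, ratExp_sum]
  have hfin : (periods f).FiniteIndex := by
    refine finiteIndex_periods_of_nsmul (N := ∏ i, (4 * a i).natAbs)
      (Finset.prod_ne_zero_iff.2 fun i _ ↦ by simp [ha0 i]) fun k l ↦ ?_
    rw [hfprod]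
    refine Finset.prod_congr rfl fun i _ ↦ ?_
    obtain ⟨m, hm⟩ := Int.natAbs_dvd.1 <| Int.natCast_dvd_natCast.2 <|
      Finset.dvd_prod_of_mem (fun i ↦ (4 * a i).natAbs) (Finset.mem_univ i)
    rw [← ratExp_gauss_add (ha0 i) (k i) (m * l i)]
    congr 3
    rw [Pi.add_apply, Pi.smul_apply, nsmul_eq_mul, hm]
    push_cast
    ring
  have h1 (i) : (periods fun k : ℤ ↦ ratExp ((k : ℚ) ^ 2 / (4 * a i))).FiniteIndex := by
    refine finiteIndex_periods_of_nsmul (N := (4 * a i).natAbs) (by simp [ha0 i]) fun k l ↦ ?_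
    obtain ⟨m, hm⟩ := (Int.dvd_natAbs (a := 4 * a i)).2 dvd_rfl
    rw [← ratExp_gauss_add (ha0 i) k (m * l), nsmul_eq_mul, hm]
    ring_nf
  have hχ (k) (l) (hl : l ∈ L.comap φ) : f (k + l) = f k * ratExp (2 * B (φ k) (φ l)) := by
    obtain ⟨n, hn⟩ := hint _ hl
    simp only [hf, map_add, LinearMap.add_apply]
    rw [hn, ← ratExp_add, ← ratExp_add_intCast (_ + 2 * _) n, hB.eq (φ l) (φ k)]
    congr 1
    ring
  have hχ' (k) (l) (_ : l ∈ L.comap φ) (l') (_ : l' ∈ L.comap φ) :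
      ratExp (2 * B (φ k) (φ (l + l'))) =
      ratExp (2 * B (φ k) (φ l)) * ratExp (2 * B (φ k) (φ l')) := by
    rw [map_add, map_add, mul_add, ratExp_add]
  have hZ (k) : k ∈ Λ.comap φ ↔ ∀ l ∈ L.comap φ, ratExp (2 * B (φ k) (φ l)) = 1 := by
    rw [AddSubgroup.mem_comap, hΛ]
    simp_rw [ratExp_eq_one_iff]
    refine ⟨fun h l hl ↦ h _ hl, fun h y hy ↦ ?_⟩
    obtain ⟨l, rfl⟩ := hφs fun i ↦ two_mul_apply_eq_intCast hB hint hy (heL i)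
    exact h l hy
  obtain ⟨r, hr, hfr⟩ := periodicMean_restrict hfin (fun k ↦ ratExp_ne_zero _) (L.comap φ)
    (Λ.comap φ) _ hχ hχ' hZ
  choose ρ hρ hρ' using fun i ↦ periodicMean_ratExp_gauss (ha0 i)
  have h2 : periodicMean f = (∏ i, ρ i : ℝ) * ∏ i, gaussPhase (SignType.sign (a i)) := by
    rw [hfprod, periodicMean_pi h1, Finset.prod_congr rfl fun i _ ↦ hρ' i,
      Finset.prod_mul_distrib, Complex.ofReal_prod]
  have h3 : periodicMean (f ∘ (Λ.comap φ).subtype) = periodicMean fun x : Λ ↦ ratExp (B x x) := by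
    refine (periodicMean_comp (f := fun x : Λ ↦ ratExp (B x x)) (φ.addSubgroupComap Λ) fun y ↦ ?_)
    obtain ⟨k, hk⟩ := hφs fun i ↦ (hΛ y).1 y.2 _ (heL i)
    refine ⟨⟨k, ?_⟩, ?_⟩
    · rw [AddSubgroup.mem_comap, hk]
      exact y.2
    · convert (periods fun x : Λ ↦ ratExp (B x x)).zero_mem
      rw [sub_eq_zero]
      exact Subtype.ext hk
  have hsign (i) : SignType.sign (B (e i) (e i)) = SignType.sign (a i) := by
    rw [ha, sign_intCast]
  simp_rw [hsign]
  refine ⟨r⁻¹ * ∏ i, ρ i, mul_pos (inv_pos.2 hr) (Finset.prod_pos fun i _ ↦ hρ i), ?_⟩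
  rw [← h3, Complex.ofReal_mul, mul_assoc, ← h2, hfr, Complex.ofReal_inv, inv_mul_cancel_left₀]
  exact_mod_cast hr.ne'

/-- Milgram's formula: the mean of a rational quadratic form over the dual of a lattice, up to a
positive factor. -/
theorem exists_periodicMean_dual {B : LinearMap.BilinForm ℚ V} (hB : B.IsSymm)
    {L Λ : AddSubgroup V} (hL : ∀ x, ∃ n : ℕ, n ≠ 0 ∧ n • x ∈ L)
    (hint : ∀ x ∈ L, ∃ n : ℤ, B x x = n)
    (hΛ : ∀ x, x ∈ Λ ↔ ∀ y ∈ L, ∃ n : ℤ, 2 * B x y = n) (e : Module.Basis ι ℚ V)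
    (he : ∀ i j, i ≠ j → B (e i) (e j) = 0) (he0 : ∀ i, B (e i) (e i) ≠ 0) :
    ∃ r : ℝ, 0 < r ∧ periodicMean (fun x : Λ ↦ ratExp (B x x)) =
      r * ∏ i, gaussPhase (SignType.sign (B (e i) (e i))) := by
  choose n hn hnL using fun i ↦ hL (e i)
  have hn' (i) : (n i : ℚ) ≠ 0 := Nat.cast_ne_zero.2 (hn i)
  let e' := e.unitsSMul fun i ↦ Units.mk0 (n i : ℚ) (hn' i)
  have he' (i) : e' i = (n i : ℚ) • e i := e.unitsSMul_apply i
  have hB' (i j) : B (e' i) (e' j) = n i * n j * B (e i) (e j) := by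
    rw [he', he', map_smul, map_smul, LinearMap.smul_apply, smul_eq_mul, smul_eq_mul]
    ring
  obtain ⟨r, hr, h⟩ := exists_periodicMean_dual_aux hB hint hΛ e'
    (fun i j hij ↦ by rw [hB', he i j hij, mul_zero])
    (fun i ↦ by rw [hB']; exact mul_ne_zero (mul_ne_zero (hn' i) (hn' i)) (he0 i))
    (fun i ↦ by rw [he', Nat.cast_smul_eq_nsmul]; exact hnL i)
  refine ⟨r, hr, h.trans ?_⟩
  congr 1
  refine Finset.prod_congr rfl fun i _ ↦ ?_
  rw [hB', sign_mul, sign_pos (mul_self_pos.2 (hn' i)), one_mul]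

end Milgram

section Signature

open NumberField.InfinitePlace Module

theorem prod_gaussPhase_eq {ι : Type*} [Fintype ι] (w : ι → ℝ) (hw : ∀ i, w i ≠ 0) :
    ∏ i, gaussPhase (SignType.sign (w i)) = gaussPhase 1 ^ {i | 0 < w i}.ncard *
      gaussPhase (-1) ^ (Fintype.card ι - {i | 0 < w i}.ncard) := by
  classical
  have h (i : ι) : gaussPhase (SignType.sign (w i)) =
      if 0 < w i then gaussPhase 1 else gaussPhase (-1) := by
    split_ifs with h
    · rw [sign_pos h]
    · rw [sign_neg (lt_of_le_of_ne (not_lt.1 h) (hw i))]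
  have hn : {i | 0 < w i}.ncard = (Finset.univ.filter fun i ↦ 0 < w i).card := by
    rw [← Set.ncard_coe_finset]
    simp
  simp_rw [h]
  rw [Finset.prod_ite, Finset.prod_const, Finset.prod_const, hn]
  have := Finset.card_filter_add_card_filter_not (s := Finset.univ) (fun i ↦ 0 < w i)
  rw [Finset.card_univ] at this
  congr 2
  omega

theorem sigPos_eq_ncard {E ι : Type*} [AddCommGroup E] [Module ℝ E] [FiniteDimensional ℝ E]
    [Fintype ι] {B : LinearMap.BilinForm ℝ E} (hB : B.IsSymm)
    (hcard : Fintype.card ι = finrank ℝ E) {v : ι → E} (hv : B.IsOrthoᵢ v)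
    (hv0 : ∀ i, B (v i) (v i) ≠ 0) :
    sigPos B.toQuadraticMap = {i | 0 < B (v i) (v i)}.ncard := by
  have hli : LinearIndependent ℝ v :=
    LinearMap.BilinForm.linearIndependent_of_iIsOrtho hv fun i ↦ hv0 i
  have : Nonempty (E →₀ ℝ) := ⟨0⟩
  classical
  let b : Basis ι ℝ E := Basis.mk hli (hli.span_eq_top_of_card_eq_finrank' hcard).ge
  have hb : ⇑b = v := Basis.coe_mk _ _
  have ho : (QuadraticMap.associated (R := ℝ) B.toQuadraticMap).IsOrthoᵢ b := by
    rw [hb, QuadraticMap.associated_left_inverse ℝ hB.eq]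
    exact hv
  have he := B.toQuadraticMap.isometryEquivBasisRepr b
  rw [QuadraticMap.basisRepr_eq_of_iIsOrtho _ _ ho] at he
  rw [QuadraticForm.sigPos_of_equiv_weightedSumSquares ⟨he⟩]
  simp [hb]

theorem prod_gaussPhase_eq_of_iIsOrtho {E ι : Type*} [AddCommGroup E] [Module ℝ E]
    [FiniteDimensional ℝ E] [Fintype ι] {B : LinearMap.BilinForm ℝ E} (hB : B.IsSymm)
    (hcard : Fintype.card ι = finrank ℝ E) {v v' : ι → E} (hv : B.IsOrthoᵢ v)
    (hv' : B.IsOrthoᵢ v') (hv0 : ∀ i, B (v i) (v i) ≠ 0) (hv0' : ∀ i, B (v' i) (v' i) ≠ 0) :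
    ∏ i, gaussPhase (SignType.sign (B (v i) (v i))) =
      ∏ i, gaussPhase (SignType.sign (B (v' i) (v' i))) := by
  rw [prod_gaussPhase_eq _ hv0, prod_gaussPhase_eq _ hv0', ← sigPos_eq_ncard hB hcard hv hv0,
    ← sigPos_eq_ncard hB hcard hv' hv0']

theorem exists_sq_eq_mixedEmbedding {K : Type*} [Field K] {p : K} (hp : ∀ σ : K →+* ℝ, 0 < σ p) :
    ∃ τ : mixedEmbedding.mixedSpace K, τ ^ 2 = mixedEmbedding K p := by
  refine ⟨(fun w ↦ √(embedding_of_isReal w.2 p),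
    fun w ↦ (w.1.embedding p) ^ ((2 : ℕ) : ℂ)⁻¹), Prod.ext (funext fun w ↦ ?_) (funext fun w ↦ ?_)⟩
  · simp [Real.sq_sqrt (hp _).le]
  · simp only [Prod.pow_snd, Pi.pow_apply, mixedEmbedding.mixedEmbedding_apply_isComplex]
    rw [Complex.cpow_nat_inv_pow _ two_ne_zero]

variable (K : Type*) [Field K] [NumberField K]

open scoped Classical in
/-- The extension of the trace of a number field `K` to the mixed space `K ⊗ ℝ`. -/
noncomputable def mixedTrace : mixedEmbedding.mixedSpace K →ₗ[ℝ] ℝ where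
  toFun x := ∑ w, x.1 w + 2 * ∑ w, (x.2 w).re
  map_add' x y := by simp [Finset.sum_add_distrib]; ring
  map_smul' r x := by simp [← Finset.mul_sum]; ring

theorem mixedTrace_mixedEmbedding (x : K) :
    mixedTrace K (mixedEmbedding K x) = Algebra.trace ℚ K x := by
  classical
  have h1 : (algebraMap ℚ ℂ (Algebra.trace ℚ K x)) = ∑ φ : K →+* ℂ, φ x := by
    rw [trace_eq_sum_embeddings ℂ]
    exact Fintype.sum_equiv (RingHom.equivRatAlgHom (R := K) (S := ℂ)).symm _ _ fun _ ↦ rfl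
  have h2 : (Algebra.trace ℚ K x : ℝ) = ∑ φ : K →+* ℂ, (φ x).re := by
    rw [← Complex.re_sum, ← h1]
    simp
  have h3 (φ : K →+* ℂ) : (φ x).re = ((mk φ).embedding x).re := by
    rcases mk_eq_iff.1 (mk_embedding (mk φ)) with h | h
    · rw [h]
    · conv_lhs => rw [← h, ComplexEmbedding.conjugate_coe_eq, Complex.conj_re]
  rw [h2]
  rw [Finset.sum_congr rfl fun φ _ ↦ h3 φ, ← Finset.sum_fiberwise (s := Finset.univ) (g := mk)]
  have h4 (w : InfinitePlace K) : ∑ φ ∈ Finset.univ.filter (fun φ ↦ InfinitePlace.mk φ = w),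
      ((mk φ).embedding x).re = w.mult * (w.embedding x).re := by
    rw [Finset.sum_congr rfl (g := fun _ ↦ (w.embedding x).re)
      (fun φ hφ ↦ by rw [(Finset.mem_filter.1 hφ).2]), Finset.sum_const, card_filter_mk_eq,
      nsmul_eq_mul]
  simp_rw [h4]
  rw [InfinitePlace.sum_eq_sum_add_sum]
  simp only [mixedTrace, LinearMap.coe_mk, AddHom.coe_mk,
    mixedEmbedding.mixedEmbedding_apply_isReal,
    mixedEmbedding.mixedEmbedding_apply_isComplex, mult_isReal, mult_isComplex, Finset.mul_sum]
  congr 1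
  · refine Finset.sum_congr rfl fun w _ ↦ ?_
    rw [← embedding_of_isReal_apply w.2, Nat.cast_one, one_mul, Complex.ofReal_re]

variable {K}

/-- The symmetric bilinear form `(x, y) ↦ Tr (u * x * y)` on a number field. -/
noncomputable def scaledTraceForm (u : K) : LinearMap.BilinForm ℚ K :=
  (Algebra.traceForm ℚ K).comp (LinearMap.mulLeft ℚ u) LinearMap.id

theorem scaledTraceForm_apply (u x y : K) :
    scaledTraceForm u x y = Algebra.trace ℚ K (u * x * y) := rfl

theorem scaledTraceForm_isSymm (u : K) : (scaledTraceForm u).IsSymm := by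
  refine ⟨fun x y ↦ ?_⟩
  simp only [scaledTraceForm_apply]
  ring_nf

theorem scaledTraceForm_nondegenerate {u : K} (hu : u ≠ 0) :
    (scaledTraceForm u).SeparatingLeft := by
  intro x hx
  have := (traceForm_nondegenerate ℚ K).1 (u * x) fun y ↦ hx y
  exact (mul_eq_zero.1 this).resolve_left hu

theorem prod_gaussPhase_scaledTraceForm {p u : K} (hp : ∀ σ : K →+* ℝ, 0 < σ p) (hp0 : p ≠ 0)
    (hu : u ≠ 0) {ι : Type*} [Fintype ι] (e e' : Basis ι ℚ K)
    (he : (scaledTraceForm u).IsOrthoᵢ e) (he' : (scaledTraceForm (p * u)).IsOrthoᵢ e') :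
    ∏ i, gaussPhase (SignType.sign (scaledTraceForm u (e i) (e i))) =
      ∏ i, gaussPhase (SignType.sign (scaledTraceForm (p * u) (e' i) (e' i))) := by
  obtain ⟨τ, hτ⟩ := exists_sq_eq_mixedEmbedding hp
  let B : LinearMap.BilinForm ℝ (mixedEmbedding.mixedSpace K) :=
    (LinearMap.mul ℝ (mixedEmbedding.mixedSpace K)).compr₂
      (mixedTrace K ∘ₗ LinearMap.mulLeft ℝ (mixedEmbedding K u))
  have hB (x y) : B x y = mixedTrace K (mixedEmbedding K u * (x * y)) := rfl
  have h1 (x y : K) : B (mixedEmbedding K x) (mixedEmbedding K y) =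
      (scaledTraceForm u x y : ℝ) := by
    rw [hB, scaledTraceForm_apply, ← mixedTrace_mixedEmbedding]
    simp only [map_mul, mul_assoc]
  have h2 (x y : K) : B (τ * mixedEmbedding K x) (τ * mixedEmbedding K y) =
      (scaledTraceForm (p * u) x y : ℝ) := by
    rw [hB, scaledTraceForm_apply, ← mixedTrace_mixedEmbedding]
    simp only [map_mul, ← hτ]
    congr 1
    ring
  have hsymm : B.IsSymm := ⟨fun x y ↦ by rw [hB, hB, mul_comm x y]⟩
  have hcard : Fintype.card ι = finrank ℝ (mixedEmbedding.mixedSpace K) := by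
    rw [mixedEmbedding.finrank, finrank_eq_card_basis e]
  have sign_cast (q : ℚ) : SignType.sign q = SignType.sign (q : ℝ) := by
    rcases lt_trichotomy q 0 with h | h | h
    · rw [sign_neg h, sign_neg (by exact_mod_cast h)]
    · simp [h]
    · rw [sign_pos h, sign_pos (by exact_mod_cast h)]
  simp_rw [sign_cast, ← h1, ← h2]
  apply prod_gaussPhase_eq_of_iIsOrtho hsymm hcard
  · intro i j hij
    have h0 : scaledTraceForm u (e i) (e j) = 0 := he hij
    exact (h1 _ _).trans (by rw [h0, Rat.cast_zero])
  · intro i j hij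
    have h0 : scaledTraceForm (p * u) (e' i) (e' j) = 0 := he' hij
    exact (h2 _ _).trans (by rw [h0, Rat.cast_zero])
  · intro i
    rw [h1]
    exact_mod_cast
      he.not_isOrtho_basis_self_of_separatingLeft (scaledTraceForm_nondegenerate hu) i
  · intro i
    rw [h2]
    exact_mod_cast he'.not_isOrtho_basis_self_of_separatingLeft
      (scaledTraceForm_nondegenerate (mul_ne_zero hp0 hu)) i

theorem exists_periodicMean_mul_eq {p u : K} (hp : ∀ σ : K →+* ℝ, 0 < σ p) (hp0 : p ≠ 0)
    (hu : u ≠ 0) {L Λ Λ' : AddSubgroup K} (hL : ∀ x, ∃ n : ℕ, n ≠ 0 ∧ n • x ∈ L)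
    (hint : ∀ x ∈ L, ∃ n : ℤ, Algebra.trace ℚ K (u * x * x) = n)
    (hint' : ∀ x ∈ L, ∃ n : ℤ, Algebra.trace ℚ K (p * u * x * x) = n)
    (hΛ : ∀ x, x ∈ Λ ↔ ∀ y ∈ L, ∃ n : ℤ, 2 * Algebra.trace ℚ K (u * x * y) = n)
    (hΛ' : ∀ x, x ∈ Λ' ↔ ∀ y ∈ L, ∃ n : ℤ, 2 * Algebra.trace ℚ K (p * u * x * y) = n) :
    ∃ r : ℝ, 0 < r ∧
      periodicMean (fun x : Λ' ↦ ratExp (Algebra.trace ℚ K (p * u * x * x))) =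
        r * periodicMean (fun x : Λ ↦ ratExp (Algebra.trace ℚ K (u * x * x))) ∧
      periodicMean (fun x : Λ ↦ ratExp (Algebra.trace ℚ K (u * x * x))) ≠ 0 := by
  obtain ⟨e, he⟩ := LinearMap.BilinForm.exists_orthogonal_basis
    (LinearMap.BilinForm.isSymm_iff.1 (scaledTraceForm_isSymm u))
  obtain ⟨e', he'⟩ := LinearMap.BilinForm.exists_orthogonal_basis
    (LinearMap.BilinForm.isSymm_iff.1 (scaledTraceForm_isSymm (p * u)))
  obtain ⟨r, hr, h⟩ := exists_periodicMean_dual (scaledTraceForm_isSymm u) hL hint hΛ e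
    (fun i j hij ↦ he hij)
    (he.not_isOrtho_basis_self_of_separatingLeft (scaledTraceForm_nondegenerate hu))
  obtain ⟨r', hr', h'⟩ := exists_periodicMean_dual (scaledTraceForm_isSymm (p * u)) hL hint' hΛ' e'
    (fun i j hij ↦ he' hij) (he'.not_isOrtho_basis_self_of_separatingLeft
      (scaledTraceForm_nondegenerate (mul_ne_zero hp0 hu)))
  simp only [scaledTraceForm_apply] at h h'
  have hprod := prod_gaussPhase_scaledTraceForm hp hp0 hu e e' he he'
  simp only [scaledTraceForm_apply] at hprod
  have hr0 : (r : ℂ) ≠ 0 := by exact_mod_cast hr.ne'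
  refine ⟨r' / r, div_pos hr' hr, ?_, ?_⟩
  · rw [h, h', hprod]
    push_cast
    field_simp
  · rw [h]
    exact mul_ne_zero hr0 (Finset.prod_ne_zero_iff.2 fun i _ ↦ gaussPhase_ne_zero _)

end Signature

section Completion

open Filter Topology WithZero

/-- Newton's step for lifting a square root. -/
theorem sq_lift_step {R : Type*} [CommRing R] {P : Ideal R} {u t w : R} {k : ℕ}
    (ht : u - t ^ 2 ∈ P ^ (k + 1)) (hw : 2 * t * w - 1 ∈ P) :
    u - (t + w * (u - t ^ 2)) ^ 2 ∈ P ^ (k + 2) ∧ 2 * (t + w * (u - t ^ 2)) * w - 1 ∈ P := by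
  constructor
  · have h1 : (u - t ^ 2) * (2 * t * w - 1) ∈ P ^ (k + 2) := by
      rw [pow_succ P (k + 1)]
      exact Ideal.mul_mem_mul ht hw
    have h2 : (u - t ^ 2) * (u - t ^ 2) ∈ P ^ (k + 2) := by
      rw [pow_succ P (k + 1)]
      exact Ideal.mul_mem_mul ht (Ideal.pow_le_self k.succ_ne_zero ht)
    convert sub_mem (neg_mem h1) (Ideal.mul_mem_left _ (w ^ 2) h2) using 1
    ring
  · convert add_mem hw (Ideal.mul_mem_left _ (2 * w ^ 2) (Ideal.pow_le_self k.succ_ne_zero ht))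
      using 1
    ring

theorem exists_sq_lift_seq {R : Type*} [CommRing R] {P : Ideal R} {u s w : R}
    (hs : u - s ^ 2 ∈ P) (hw : 2 * s * w - 1 ∈ P) :
    ∃ t : ℕ → R, (∀ k, u - t k ^ 2 ∈ P ^ (k + 1)) ∧ ∀ k, t (k + 1) - t k ∈ P ^ (k + 1) := by
  let t : ℕ → R := fun n ↦ Nat.rec s (fun _ t ↦ t + w * (u - t ^ 2)) n
  have ht (k : ℕ) : t (k + 1) = t k + w * (u - t k ^ 2) := rfl
  have h (k : ℕ) : u - t k ^ 2 ∈ P ^ (k + 1) ∧ 2 * t k * w - 1 ∈ P := by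
    induction k with
    | zero => simpa using ⟨hs, hw⟩
    | succ k ih =>
      rw [ht]
      exact sq_lift_step ih.1 ih.2
  refine ⟨t, fun k ↦ (h k).1, fun k ↦ ?_⟩
  rw [ht, add_sub_cancel_left]
  exact Ideal.mul_mem_left _ _ (h k).1

variable {F : Type*} [Field F] [Valued F ℤᵐ⁰]

theorem Valued.exists_forall_le_exp_neg_lt
    (γ : (MonoidWithZeroHom.ValueGroup₀ (.ofClass (Valued.v : Valuation F ℤᵐ⁰)))ˣ) :
    ∃ n : ℕ, ∀ x : F, Valued.v x ≤ exp (-(n : ℤ)) → Valued.v.restrict x < γ.1 := by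
  obtain ⟨n, hn⟩ := exists_pow_lt₀ (a := exp (-1 : ℤ)) (by rw [← exp_zero, exp_lt_exp]; simp)
    (Units.map (MonoidWithZeroHom.ValueGroup₀.embedding
      (f := (.ofClass (Valued.v : Valuation F ℤᵐ⁰)))) γ)
  refine ⟨n, fun x hx ↦ ?_⟩
  rw [Valuation.restrict_lt_iff_lt_embedding]
  refine lt_of_le_of_lt hx ?_
  simpa [← exp_nsmul] using hn

theorem Valued.tendsto_zero_of_le_exp {x : ℕ → F} (hx : ∀ n : ℕ, Valued.v (x n) ≤ exp (-(n : ℤ))) :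
    Tendsto x atTop (𝓝 0) := by
  refine (Valued.hasBasis_nhds_zero F ℤᵐ⁰).tendsto_right_iff.2 fun γ _ ↦ ?_
  obtain ⟨n, hn⟩ := Valued.exists_forall_le_exp_neg_lt γ
  refine eventually_atTop.2 ⟨n, fun m hm ↦ hn _ ((hx m).trans ?_)⟩
  rw [exp_le_exp]
  omega

theorem Valued.cauchySeq_of_sub_le_exp {x : ℕ → F}
    (hx : ∀ n : ℕ, Valued.v (x (n + 1) - x n) ≤ exp (-(n : ℤ))) : CauchySeq x := by
  refine Valued.cauchy_iff.2 ⟨inferInstance, fun γ ↦ ?_⟩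
  obtain ⟨n, hn⟩ := Valued.exists_forall_le_exp_neg_lt γ
  have key (m k : ℕ) : Valued.v (x (m + k) - x m) ≤ exp (-(m : ℤ)) := by
    induction k with
    | zero => simp
    | succ k ih =>
      rw [← add_assoc, ← sub_add_sub_cancel _ (x (m + k))]
      refine (Valuation.map_add_le _ ((hx _).trans ?_) ih)
      rw [exp_le_exp, Nat.cast_add]
      omega
  have key' (m : ℕ) (hm : n ≤ m) : Valued.v (x m - x n) ≤ exp (-(n : ℤ)) := by
    obtain ⟨k, rfl⟩ := Nat.exists_eq_add_of_le hm
    exact key n k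
  refine ⟨x '' Set.Ici n, image_mem_map (Ici_mem_atTop n), ?_⟩
  rintro _ ⟨i, hi, rfl⟩ _ ⟨j, hj, rfl⟩
  refine hn _ ?_
  rw [← sub_sub_sub_cancel_right _ _ (x n)]
  exact Valuation.map_sub_le _ (key' j hj) (key' i hi)

variable {R : Type*} [CommRing R] [IsDedekindDomain R] {K : Type*} [Field K] [Algebra R K]
  [IsFractionRing R K] (v : HeightOneSpectrum R)

theorem valued_algebraMap_le_exp_iff {r : R} {n : ℕ} :
    Valued.v (algebraMap R (v.adicCompletion K) r) ≤ exp (-(n : ℤ)) ↔ r ∈ v.asIdeal ^ n := by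
  rw [← v.intValuation_le_pow_iff_mem, ← v.valuation_of_algebraMap (K := K),
    ← v.valuedAdicCompletion_eq_valuation]

theorem exists_algebraMap_sub_le_exp {y : v.adicCompletion K} (hy : Valued.v y ≤ 1) (k : ℕ) :
    ∃ s : R, Valued.v (algebraMap R (v.adicCompletion K) s - y) ≤ exp (-(k : ℤ)) := by
  obtain ⟨π, hπ⟩ := v.valuation_exists_uniformizer K
  have hπk : Valued.v (algebraMap K (v.adicCompletion K) (π ^ k)) = exp (-(k : ℤ)) := by
    refine (v.valuedAdicCompletion_eq_valuation' (π ^ k)).trans ?_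
    rw [map_pow, hπ, ← exp_nsmul]
    simp
  have hmem : {x : v.adicCompletion K | Valued.v (x - y) < exp (-(k : ℤ))} ∈ 𝓝 y := by
    refine Valued.mem_nhds.2 ⟨Units.mk0
      (Valued.v.restrict (algebraMap K (v.adicCompletion K) (π ^ k))) ?_, fun x hx ↦ ?_⟩
    · rw [ne_eq, Valuation.restrict_eq_zero_iff, hπk]
      exact exp_ne_zero
    · rw [Set.mem_ofPred_eq, ← hπk]
      exact Valuation.restrict_lt_iff _ |>.1 hx
  obtain ⟨x, hx⟩ := (v.denseRange_algebraMap (K := K)).mem_nhds hmem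
  rw [Set.mem_ofPred_eq] at hx
  have hx1 : v.valuation K x ≤ 1 := by
    refine (v.valuedAdicCompletion_eq_valuation' x).symm.trans_le ?_
    have := Valuation.map_add_le Valued.v (hx.le.trans (show exp (-(k : ℤ)) ≤ 1 by
      rw [← exp_zero, exp_le_exp]; omega)) hy
    rwa [sub_add_cancel] at this
  obtain ⟨s, hs⟩ := v.exists_valuation_sub_lt_of_integer hx1
    (Units.mk0 (exp (-(k : ℤ))) exp_ne_zero)
  refine ⟨s, ?_⟩
  rw [← sub_add_sub_cancel _ (algebraMap K (v.adicCompletion K) x)]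
  refine Valuation.map_add_le _ ?_ hx.le
  rw [IsScalarTower.algebraMap_apply R K, ← map_sub]
  exact (v.valuedAdicCompletion_eq_valuation' _).trans_le hs.le

/-- An integral square in the completion is a square modulo all powers of the prime. -/
theorem exists_sub_sq_mem_pow {a : R} (ha : IsSquare (algebraMap R (v.adicCompletion K) a))
    (k : ℕ) : ∃ s, a - s ^ 2 ∈ v.asIdeal ^ k := by
  obtain ⟨y, hy⟩ := ha
  have hv1 : Valued.v (algebraMap R (v.adicCompletion K) a) ≤ 1 := by
    simpa using (valued_algebraMap_le_exp_iff (K := K) v (r := a) (n := 0)).2 (by simp)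
  have hy1 : Valued.v y ≤ 1 := by
    rw [hy, map_mul] at hv1
    by_contra! h
    exact absurd (one_lt_mul'' h h |>.trans_le hv1) (lt_irrefl _)
  obtain ⟨s, hs⟩ := exists_algebraMap_sub_le_exp v hy1 k
  refine ⟨s, ?_⟩
  have hs1 : Valued.v (algebraMap R (v.adicCompletion K) s) ≤ 1 := by
    simpa using (valued_algebraMap_le_exp_iff (K := K) v (r := s) (n := 0)).2 (by simp)
  rw [← valued_algebraMap_le_exp_iff (K := K), map_sub, hy, map_pow,
    show y * y - algebraMap R (v.adicCompletion K) s ^ 2 =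
      (-(algebraMap R (v.adicCompletion K) s - y)) *
        (y + algebraMap R (v.adicCompletion K) s) by ring, map_mul, Valuation.map_neg]
  exact (mul_le_of_le_one_right' (Valuation.map_add_le _ hy1 hs1)).trans hs

theorem isSquare_of_sub_sq_mem {a s w : R} (hs : a - s ^ 2 ∈ v.asIdeal)
    (hw : 2 * s * w - 1 ∈ v.asIdeal) : IsSquare (algebraMap R (v.adicCompletion K) a) := by
  obtain ⟨t, ht, ht'⟩ := exists_sq_lift_seq hs hw
  have hc : CauchySeq fun n ↦ algebraMap R (v.adicCompletion K) (t n) := by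
    refine Valued.cauchySeq_of_sub_le_exp fun n ↦ ?_
    rw [← map_sub, valued_algebraMap_le_exp_iff]
    exact Ideal.pow_le_pow_right n.le_succ (ht' n)
  obtain ⟨y, hy⟩ := cauchySeq_tendsto_of_complete hc
  have h0 : Tendsto (fun n ↦ algebraMap R (v.adicCompletion K) (a - t n ^ 2)) atTop (𝓝 0) := by
    refine Valued.tendsto_zero_of_le_exp fun n ↦ ?_
    rw [valued_algebraMap_le_exp_iff]
    exact Ideal.pow_le_pow_right n.le_succ (ht n)
  have h1 : Tendsto (fun n ↦ algebraMap R (v.adicCompletion K) (a - t n ^ 2)) atTop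
      (𝓝 (algebraMap R (v.adicCompletion K) a - y ^ 2)) := by
    simp only [map_sub, map_pow]
    exact (hy.pow 2).const_sub _
  exact ⟨y, by rw [← sq, ← sub_eq_zero, tendsto_nhds_unique h1 h0]⟩

end Completion

section Representation

theorem exists_mul_sub_one_mem_pow {R : Type*} [CommRing R] {P : Ideal R} [P.IsMaximal] {a : R}
    (ha : a ∉ P) (k : ℕ) : ∃ b, a * b - 1 ∈ P ^ k := by
  obtain ⟨b, hb⟩ := (Ideal.Quotient.isUnit_mk_pow_of_notMem P (n := k) ha).exists_right_inv
  obtain ⟨b, rfl⟩ := Ideal.Quotient.mk_surjective b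
  exact ⟨b, by rwa [← map_mul, ← map_one (Ideal.Quotient.mk _), Ideal.Quotient.mk_eq_mk_iff_sub_mem]
    at hb⟩

theorem exists_lift_of_mul_sq_add_mul_sq {R : Type*} [CommRing R] {P : Ideal R} [P.IsMaximal]
    {a b x y : R} (h2 : (2 : R) ∉ P) (ha : a ∉ P) (hx : x ∉ P)
    (h : a * x ^ 2 + b * y ^ 2 - 1 ∈ P) (k : ℕ) : ∃ t, a * t ^ 2 + b * y ^ 2 - 1 ∈ P ^ k := by
  obtain ⟨a', ha'⟩ := exists_mul_sub_one_mem_pow ha (k + 1)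
  have hP : P.IsPrime := Ideal.IsMaximal.isPrime inferInstance
  obtain ⟨w, hw⟩ := exists_mul_sub_one_mem_pow (hP.mul_notMem h2 hx) 1
  rw [pow_one] at hw
  have hs : a' * (1 - b * y ^ 2) - x ^ 2 ∈ P := by
    convert sub_mem (Ideal.mul_mem_left _ (x ^ 2) (Ideal.pow_le_self k.succ_ne_zero ha'))
      (Ideal.mul_mem_left _ a' h) using 1
    ring
  obtain ⟨t, ht, -⟩ := exists_sq_lift_seq hs hw
  refine ⟨t k, Ideal.pow_le_pow_right k.le_succ ?_⟩
  convert sub_mem (Ideal.mul_mem_left _ (1 - b * y ^ 2) ha') (Ideal.mul_mem_left _ a (ht k)) using 1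
  ring

theorem exists_mul_sq_add_mul_sq_sub_one_mem_of_odd {R : Type*} [CommRing R] {P : Ideal R}
    [P.IsMaximal] [Finite (R ⧸ P)] {a b : R} (h2 : (2 : R) ∉ P) (ha : a ∉ P) (hb : b ∉ P) :
    ∃ x y, a * x ^ 2 + b * y ^ 2 - 1 ∈ P := by
  classical
  let _ := Fintype.ofFinite (R ⧸ P)
  let _ := Ideal.Quotient.field P
  have hodd : Fintype.card (R ⧸ P) % 2 = 1 := by
    refine FiniteField.odd_card_of_char_ne_two fun h ↦ h2 ?_
    rw [← Ideal.Quotient.eq_zero_iff_mem, map_ofNat]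
    have := ringChar.Nat.cast_ringChar (R := R ⧸ P)
    rw [h] at this
    exact_mod_cast this
  have ha' : Ideal.Quotient.mk P a ≠ 0 := fun h ↦ ha (Ideal.Quotient.eq_zero_iff_mem.1 h)
  have hb' : Ideal.Quotient.mk P b ≠ 0 := fun h ↦ hb (Ideal.Quotient.eq_zero_iff_mem.1 h)
  open Polynomial in
  obtain ⟨x, y, hxy⟩ := FiniteField.exists_root_sum_quadratic
    (f := C (Ideal.Quotient.mk P a) * X ^ 2 + C 0 * X + C (-1))
    (g := C (Ideal.Quotient.mk P b) * X ^ 2 + C 0 * X + C 0)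
    (degree_quadratic ha') (degree_quadratic hb') hodd
  obtain ⟨x, rfl⟩ := Ideal.Quotient.mk_surjective x
  obtain ⟨y, rfl⟩ := Ideal.Quotient.mk_surjective y
  refine ⟨x, y, Ideal.Quotient.eq_zero_iff_mem.1 ?_⟩
  simp at hxy
  simp only [map_sub, map_add, map_mul, map_pow, map_one]
  linear_combination hxy

theorem exists_mul_sq_add_mul_sq_sub_one_mem_pow_of_odd {R : Type*} [CommRing R] {P : Ideal R}
    [P.IsMaximal] [Finite (R ⧸ P)] {a b : R} (h2 : (2 : R) ∉ P) (ha : a ∉ P) (hb : b ∉ P)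
    (k : ℕ) : ∃ x y, a * x ^ 2 + b * y ^ 2 - 1 ∈ P ^ k := by
  obtain ⟨x, y, h⟩ := exists_mul_sq_add_mul_sq_sub_one_mem_of_odd h2 ha hb
  by_cases hx : x ∈ P
  · have hy : y ∉ P := by
      refine fun hy ↦ Ideal.IsMaximal.ne_top (I := P) inferInstance ((Ideal.eq_top_iff_one P).2 ?_)
      convert sub_mem (add_mem (Ideal.mul_mem_left _ (a * x) hx)
          (Ideal.mul_mem_left _ (b * y) hy)) h
        using 1
      ring
    obtain ⟨t, ht⟩ := exists_lift_of_mul_sq_add_mul_sq h2 hb hy (by rwa [add_comm]) k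
    exact ⟨x, t, by rwa [add_comm] at ht⟩
  · obtain ⟨t, ht⟩ := exists_lift_of_mul_sq_add_mul_sq h2 ha hx h k
    exact ⟨t, y, ht⟩

theorem exists_mul_sq_add_mul_sq_sub_one_mem_pow_of_sub_sq {R : Type*} [CommRing R] {P : Ideal R}
    [P.IsMaximal] {a : R} (b : R) (ha : a ∉ P) {k : ℕ} (h : ∃ s, a - s ^ 2 ∈ P ^ k) :
    ∃ x y, a * x ^ 2 + b * y ^ 2 - 1 ∈ P ^ k := by
  obtain rfl | hk := eq_or_ne k 0
  · simp
  obtain ⟨s, hs⟩ := h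
  have hs' : s ∉ P := fun h ↦ ha <| by
    convert add_mem (Ideal.pow_le_self hk hs) (Ideal.mul_mem_left _ s h) using 1
    ring
  obtain ⟨t, ht⟩ := exists_mul_sub_one_mem_pow hs' k
  refine ⟨t, 0, ?_⟩
  convert add_mem (Ideal.mul_mem_left _ (t ^ 2) hs) (Ideal.mul_mem_left _ (s * t + 1) ht) using 1
  ring

theorem exists_mul_sq_add_mul_sq_sub_one_mem {R : Type*} [CommRing R] [IsDedekindDomain R]
    (hfin : ∀ v : HeightOneSpectrum R, Finite (R ⧸ v.asIdeal)) {a b : R}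
    (h2 : ∀ v : HeightOneSpectrum R, (2 : R) ∈ v.asIdeal → ∀ k, ∃ s, a - s ^ 2 ∈ v.asIdeal ^ k)
    (I : Ideal R) (hI0 : I ≠ ⊥)
    (hI : ∀ v : HeightOneSpectrum R, I ≤ v.asIdeal → a ∉ v.asIdeal ∧ b ∉ v.asIdeal) :
    ∃ x y, a * x ^ 2 + b * y ^ 2 - 1 ∈ I := by
  induction I using UniqueFactorizationMonoid.induction_on_coprime with
  | h0 => exact absurd rfl hI0
  | h1 h =>
    rw [Ideal.isUnit_iff] at h
    simp [h]
  | hpr i hp =>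
    rename_i p
    obtain rfl | hi := eq_or_ne i 0
    · simp
    let v : HeightOneSpectrum R := ⟨p, Ideal.isPrime_of_prime hp, hp.ne_zero⟩
    have := hfin v
    have : v.asIdeal.IsMaximal := v.isMaximal
    obtain ⟨ha, hb⟩ := hI v (Ideal.pow_le_self hi)
    by_cases h : (2 : R) ∈ v.asIdeal
    · exact exists_mul_sq_add_mul_sq_sub_one_mem_pow_of_sub_sq (P := v.asIdeal) b ha (h2 v h i)
    · exact exists_mul_sq_add_mul_sq_sub_one_mem_pow_of_odd (P := v.asIdeal) h ha hb i
  | hcp hIJ ih ih' =>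
    rename_i I J
    obtain ⟨x, y, h⟩ := ih (left_ne_zero_of_mul hI0) fun v hv ↦ hI v (Ideal.mul_le_left.trans hv)
    obtain ⟨x', y', h'⟩ := ih' (right_ne_zero_of_mul hI0) fun v hv ↦
      hI v (Ideal.mul_le_right.trans hv)
    have hc : IsCoprime I J := by
      rw [Ideal.isCoprime_iff_sup_eq, ← Ideal.isUnit_iff]
      exact hIJ (Ideal.dvd_iff_le.2 le_sup_left) (Ideal.dvd_iff_le.2 le_sup_right)
    obtain ⟨e, he, f, hf, hef⟩ := Ideal.isCoprime_iff_exists.1 hc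
    refine ⟨x * f + x' * e, y * f + y' * e, ?_⟩
    rw [Ideal.mul_eq_inf_of_isCoprime hc]
    refine Ideal.mem_inf.2 ⟨?_, ?_⟩
    · rw [show f = 1 - e by linear_combination hef]
      convert add_mem h (Ideal.mul_mem_left _ (a * (x' - x) * (2 * x + (x' - x) * e) +
        b * (y' - y) * (2 * y + (y' - y) * e)) he) using 1
      ring
    · rw [show e = 1 - f by linear_combination hef]
      convert add_mem h' (Ideal.mul_mem_left _ (a * (x - x') * (2 * x' + (x - x') * f) +
        b * (y - y') * (2 * y' + (y - y') * f)) hf) using 1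
      ring

end Representation

section InverseDifferent

variable {K : Type*} [Field K]

theorem mul_mem_fractionalIdeal {I : FractionalIdeal (nonZeroDivisors (𝓞 K)) K} {x : K}
    (a : 𝓞 K) (hx : x ∈ I) : a * x ∈ I := by
  have h : a • x = a * x := Algebra.smul_def a x
  exact h ▸ Submodule.smul_mem (I : Submodule (𝓞 K) K) a hx

theorem div_mem_of_mul_div_mem {I : FractionalIdeal (nonZeroDivisors (𝓞 K)) K} {p q : 𝓞 K}
    (hp : p ≠ 0) (hpq : IsCoprime p q) {x : K} (hx : x ∈ I) (h : q * x / p ∈ I) : x / p ∈ I := by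
  obtain ⟨a, b, hab⟩ := hpq
  have hp0 : (p : K) ≠ 0 := by exact_mod_cast hp
  have hab' : (a * p + b * q : K) = 1 := by exact_mod_cast congrArg (algebraMap (𝓞 K) K) hab
  have h1 : x / p = a * x + b * (q * x / p) := by
    field_simp
    linear_combination -x * hab'
  rw [h1]
  exact Submodule.add_mem (I : Submodule (𝓞 K) K) (mul_mem_fractionalIdeal a hx)
    (mul_mem_fractionalIdeal b h)

variable (K) [NumberField K]

/-- The inverse different of a number field: the dual of its ring of integers under the trace. -/
noncomputable def inverseDifferent : FractionalIdeal (nonZeroDivisors (𝓞 K)) K :=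
  FractionalIdeal.dual ℤ ℚ 1

variable {K}

theorem mem_inverseDifferent {x : K} : x ∈ inverseDifferent K ↔
    ∀ y : 𝓞 K, ∃ n : ℤ, Algebra.trace ℚ K (x * y) = n := by
  have h1 : (1 : FractionalIdeal (nonZeroDivisors (𝓞 K)) K) ≠ 0 := one_ne_zero
  rw [inverseDifferent, FractionalIdeal.mem_dual h1]
  simp only [FractionalIdeal.mem_one_iff, forall_exists_index, forall_apply_eq_imp_iff,
    Algebra.traceForm_apply, RingHom.mem_range]
  exact forall_congr' fun y ↦ exists_congr fun n ↦ eq_comm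

theorem inverseDifferent_ne_zero : inverseDifferent K ≠ 0 :=
  FractionalIdeal.dual_ne_zero _ _ one_ne_zero

theorem exists_mem_fractionalIdeal_div_notMem {I : FractionalIdeal (nonZeroDivisors (𝓞 K)) K}
    (hI : I ≠ 0) {p : 𝓞 K} (hp : Prime p) : ∃ x ∈ I, x / p ∉ I := by
  by_contra! h
  have hp0 : (p : K) ≠ 0 := by exact_mod_cast hp.ne_zero
  have h1 : FractionalIdeal.spanSingleton (nonZeroDivisors (𝓞 K)) (1 / p : K) * I ≤ I :=
    FractionalIdeal.spanSingleton_mul_le_iff.2 fun z hz ↦ by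
      rw [one_div_mul_eq_div]
      exact h z hz
  have h2 : FractionalIdeal.spanSingleton (nonZeroDivisors (𝓞 K)) (1 / p : K) ≤ 1 := by
    calc _ = FractionalIdeal.spanSingleton (nonZeroDivisors (𝓞 K)) (1 / p : K) * I * I⁻¹ := by
          rw [mul_assoc, mul_inv_cancel₀ hI, mul_one]
      _ ≤ I * I⁻¹ := mul_le_mul_left h1 _
      _ = 1 := mul_inv_cancel₀ hI
  rw [FractionalIdeal.spanSingleton_le_iff_mem, FractionalIdeal.mem_one_iff] at h2
  obtain ⟨y, hy⟩ := h2
  refine hp.not_isUnit (IsUnit.of_mul_eq_one y ?_)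
  apply RingOfIntegers.ext
  push_cast
  exact (congrArg (_ * ·) hy).trans (mul_one_div_cancel hp0)

theorem exists_mem_inverseDifferent_div_notMem {p₁ p₂ : 𝓞 K} (hp₁ : Prime p₁) (hp₂ : Prime p₂)
    (h : IsCoprime p₁ p₂) : ∃ c ∈ inverseDifferent K,
      c / p₁ ∉ inverseDifferent K ∧ c / p₂ ∉ inverseDifferent K := by
  obtain ⟨c₁, hc₁, hc₁'⟩ := exists_mem_fractionalIdeal_div_notMem inverseDifferent_ne_zero hp₁
  obtain ⟨c₂, hc₂, hc₂'⟩ := exists_mem_fractionalIdeal_div_notMem inverseDifferent_ne_zero hp₂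
  have h₁ : (p₁ : K) ≠ 0 := by exact_mod_cast hp₁.ne_zero
  have h₂ : (p₂ : K) ≠ 0 := by exact_mod_cast hp₂.ne_zero
  let J : Submodule (𝓞 K) K := inverseDifferent K
  refine ⟨p₂ * c₁ + p₁ * c₂, J.add_mem (mul_mem_fractionalIdeal _ hc₁)
    (mul_mem_fractionalIdeal _ hc₂), fun hm ↦ hc₁' ?_, fun hm ↦ hc₂' ?_⟩
  · refine div_mem_of_mul_div_mem hp₁.ne_zero h hc₁ ?_
    change _ ∈ J
    convert J.sub_mem hm hc₂ using 1
    field_simp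
    ring
  · refine div_mem_of_mul_div_mem hp₂.ne_zero h.symm hc₂ ?_
    change _ ∈ J
    convert J.sub_mem hm hc₁ using 1
    field_simp
    ring

theorem exists_denominator_not_dvd {p : 𝓞 K} (hp : Prime p) (h2 : IsCoprime p 2) {c : K}
    (hc : c ∈ inverseDifferent K) (hcp : c / p ∉ inverseDifferent K) :
    ∃ n : 𝓞 K, ¬ p ∣ n ∧ ∀ x : K, 2 * c * x ∈ inverseDifferent K → ∃ a : 𝓞 K, (a : K) = n * x := by
  by_contra! hcon
  have hp0 : (p : K) ≠ 0 := by exact_mod_cast hp.ne_zero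
  refine hcp (div_mem_of_mul_div_mem hp.ne_zero h2 hc ?_)
  set J := inverseDifferent K
  have h2K : ((2 : 𝓞 K) : K) = 2 := map_ofNat (algebraMap (𝓞 K) K) 2
  have h2a (a : 𝓞 K) : ((2 * a : 𝓞 K) : K) = 2 * a := by
    rw [two_mul, two_mul]
    push_cast
    rfl
  have hJ : J ≠ 0 := inverseDifferent_ne_zero
  have h1 : FractionalIdeal.spanSingleton (nonZeroDivisors (𝓞 K)) ((2 : 𝓞 K) * c / p : K) * J⁻¹
      ≤ 1 := by
    refine FractionalIdeal.spanSingleton_mul_le_iff.2 fun y hy ↦ ?_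
    rw [FractionalIdeal.mem_inv_iff hJ] at hy
    obtain ⟨a, ha⟩ := (FractionalIdeal.mem_one_iff _).1 (hy c hc)
    have hdvd : p ∣ 2 * a := by
      by_contra hpa
      obtain ⟨x, hx, hx'⟩ := hcon (2 * a) hpa
      obtain ⟨b, hb⟩ := (FractionalIdeal.mem_one_iff _).1 (hy _ hx)
      refine hx' b ?_
      rw [h2a]
      linear_combination hb - 2 * x * ha
    obtain ⟨d, hd⟩ := hdvd
    refine (FractionalIdeal.mem_one_iff _).2 ⟨d, ?_⟩
    have hd' : ((2 * a : 𝓞 K) : K) = (p * d : 𝓞 K) := by rw [hd]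
    rw [h2a] at hd'
    push_cast at hd'
    rw [h2K]
    field_simp
    linear_combination 2 * ha - hd'
  rw [← FractionalIdeal.spanSingleton_le_iff_mem]
  calc _ = FractionalIdeal.spanSingleton (nonZeroDivisors (𝓞 K)) ((2 : 𝓞 K) * c / p : K) *
        J⁻¹ * J := by rw [mul_assoc, inv_mul_cancel₀ hJ, mul_one]
    _ ≤ 1 * J := mul_le_mul_left h1 _
    _ = J := one_mul J

theorem exists_denominator_not_dvd_not_dvd {p₁ p₂ : 𝓞 K} (hp₁ : Prime p₁) (hp₂ : Prime p₂)
    (h : IsCoprime p₁ p₂) (h₁ : IsCoprime p₁ 2) (h₂ : IsCoprime p₂ 2) {c : K}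
    (hc : c ∈ inverseDifferent K) (hc₁ : c / p₁ ∉ inverseDifferent K)
    (hc₂ : c / p₂ ∉ inverseDifferent K) : ∃ n : 𝓞 K, ¬ p₁ ∣ n ∧ ¬ p₂ ∣ n ∧
      ∀ x : K, 2 * c * x ∈ inverseDifferent K → ∃ a : 𝓞 K, (a : K) = n * x := by
  obtain ⟨n₁, hn₁, h₁⟩ := exists_denominator_not_dvd hp₁ h₁ hc hc₁
  obtain ⟨n₂, hn₂, h₂⟩ := exists_denominator_not_dvd hp₂ h₂ hc hc₂
  refine ⟨p₂ * n₁ + p₁ * n₂, ?_, ?_, fun x hx ↦ ?_⟩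
  · rw [dvd_add_left (dvd_mul_right _ _)]
    exact fun hd ↦ hn₁ (h.dvd_of_dvd_mul_left hd)
  · rw [dvd_add_right (dvd_mul_right _ _)]
    exact fun hd ↦ hn₂ (h.symm.dvd_of_dvd_mul_left hd)
  · obtain ⟨a₁, ha₁⟩ := h₁ x hx
    obtain ⟨a₂, ha₂⟩ := h₂ x hx
    refine ⟨p₂ * a₁ + p₁ * a₂, ?_⟩
    push_cast
    linear_combination p₂ * ha₁ + p₁ * ha₂

end InverseDifferent

section QuadraticMean

variable {K : Type*} [Field K]

theorem coe_integer_add (a b : 𝓞 K) : ((a + b : 𝓞 K) : K) = a + b := rfl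

theorem coe_integer_mul (a b : 𝓞 K) : ((a * b : 𝓞 K) : K) = a * b := rfl

variable [NumberField K]

theorem exists_trace_eq_of_mem_inverseDifferent {x : K} (hx : x ∈ inverseDifferent K) :
    ∃ n : ℤ, Algebra.trace ℚ K x = n := by
  simpa using mem_inverseDifferent.1 hx 1

theorem ratExp_trace_add {x y : K} (hy : y ∈ inverseDifferent K) :
    ratExp (Algebra.trace ℚ K (x + y)) = ratExp (Algebra.trace ℚ K x) := by
  obtain ⟨n, hn⟩ := exists_trace_eq_of_mem_inverseDifferent hy
  rw [map_add, hn, ratExp_add_intCast]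

theorem add_mem_inverseDifferent {x y : K} (hx : x ∈ inverseDifferent K)
    (hy : y ∈ inverseDifferent K) : x + y ∈ inverseDifferent K :=
  Submodule.add_mem (inverseDifferent K : Submodule (𝓞 K) K) hx hy

/-- The elements `x` with `2 * w * x` in the inverse different. -/
noncomputable def halfDual (w : K) : Submodule (𝓞 K) K where
  carrier := {x | 2 * w * x ∈ inverseDifferent K}
  zero_mem' := by
    rw [Set.mem_ofPred_eq, mul_zero]
    exact Submodule.zero_mem (inverseDifferent K : Submodule (𝓞 K) K)
  add_mem' {x y} hx hy := by
    simpa [mul_add] using add_mem_inverseDifferent hx hy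
  smul_mem' a x hx := by
    have h := mul_mem_fractionalIdeal a hx
    change 2 * w * (a • x) ∈ inverseDifferent K
    rw [Algebra.smul_def]
    convert h using 1
    exact mul_left_comm _ _ _

theorem mem_halfDual {w x : K} : x ∈ halfDual w ↔ 2 * w * x ∈ inverseDifferent K := Iff.rfl

theorem intCast_mem_halfDual {w : K} (hw : w ∈ inverseDifferent K) (a : 𝓞 K) :
    (a : K) ∈ halfDual w := by
  rw [mem_halfDual, mul_assoc, two_mul, mul_comm w]
  exact add_mem_inverseDifferent (mul_mem_fractionalIdeal a hw) (mul_mem_fractionalIdeal a hw)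

/-- The mean of the phase of the form `t * w * x ^ 2` over `halfDual w`. -/
noncomputable def quadMean (w : K) (t : 𝓞 K) : ℂ :=
  periodicMean fun x : halfDual w ↦ ratExp (Algebra.trace ℚ K (t * w * x * x))

/-- The mean of the phase of the form `w * y ^ 2` over the ring of integers. -/
noncomputable def integralMean (w : K) : ℂ :=
  periodicMean fun y : 𝓞 K ↦ ratExp (Algebra.trace ℚ K (w * y * y))

theorem intCast_mem_periods {w : K} (hw : w ∈ inverseDifferent K) (t a : 𝓞 K) :
    ⟨a, intCast_mem_halfDual hw a⟩ ∈
      periods fun x : halfDual w ↦ ratExp (Algebra.trace ℚ K (t * w * x * x)) := by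
  rintro ⟨x, hx⟩
  have h1 := add_mem_inverseDifferent (mul_mem_fractionalIdeal (t * a) hx)
    (mul_mem_fractionalIdeal (t * a * a) hw)
  change ratExp (Algebra.trace ℚ K (t * w * (x + a) * (x + a))) =
    ratExp (Algebra.trace ℚ K (t * w * x * x))
  refine Eq.trans ?_ (ratExp_trace_add h1)
  congr 2
  simp only [coe_integer_mul]
  ring

theorem exists_ne_zero_natCast_mem {n : 𝓞 K} (hn : n ≠ 0) :
    ∃ N : ℕ, N ≠ 0 ∧ ∃ m : 𝓞 K, (N : 𝓞 K) = m * n := by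
  refine ⟨Ideal.absNorm (Ideal.span {n}), by simpa using hn, ?_⟩
  obtain ⟨m, hm⟩ := Ideal.mem_span_singleton'.1 (Ideal.absNorm_mem (Ideal.span {n}))
  exact ⟨m, hm.symm⟩

theorem fg_halfDual {w : K} {n : 𝓞 K} (hn : n ≠ 0)
    (hD : ∀ x ∈ halfDual w, ∃ a : 𝓞 K, (a : K) = n * x) : AddGroup.FG (halfDual w) := by
  choose f hf using fun x : halfDual w ↦ hD x x.2
  have hn0 : (n : K) ≠ 0 := by exact_mod_cast hn
  let F : halfDual w →+ 𝓞 K := AddMonoidHom.mk' f fun x y ↦ by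
    apply RingOfIntegers.ext
    rw [coe_integer_add, hf, hf, hf, ← mul_add]
    rfl
  have hF : Function.Injective F.toIntLinearMap := fun x y hxy ↦ by
    have h : ((f x : 𝓞 K) : K) = f y := congrArg (fun z : 𝓞 K ↦ (z : K)) hxy
    rw [hf, hf] at h
    exact Subtype.ext (mul_left_cancel₀ hn0 h)
  have := Module.Finite.of_injective _ hF
  exact Module.Finite.iff_addGroup_fg.1 this

theorem finiteIndex_periods_halfDual {w : K} (hw : w ∈ inverseDifferent K) {n : 𝓞 K} (hn : n ≠ 0)
    (hD : ∀ x ∈ halfDual w, ∃ a : 𝓞 K, (a : K) = n * x) (t : 𝓞 K) :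
    (periods fun x : halfDual w ↦ ratExp (Algebra.trace ℚ K (t * w * x * x))).FiniteIndex := by
  have := fg_halfDual hn hD
  obtain ⟨N, hN, m, hm⟩ := exists_ne_zero_natCast_mem hn
  refine finiteIndex_periods_of_nsmul hN fun x y ↦ ?_
  obtain ⟨a, ha⟩ := hD y y.2
  have h : N • y = ⟨(m * a : 𝓞 K), intCast_mem_halfDual hw _⟩ := by
    apply Subtype.ext
    have hm' : (N : K) = m * n := by
      rw [← coe_integer_mul, ← hm]
      exact (map_natCast (algebraMap (𝓞 K) K) N).symm
    change N • (y : K) = (m * a : 𝓞 K)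
    rw [coe_integer_mul, ha, nsmul_eq_mul, hm', mul_assoc]
  rw [h]
  exact intCast_mem_periods hw t _ x

theorem mul_mem_periods_integral {w : K} (hw : w ∈ inverseDifferent K) {p : 𝓞 K} (hp : p ≠ 0)
    (a : 𝓞 K) :
    p * a ∈ periods fun y : 𝓞 K ↦ ratExp (Algebra.trace ℚ K (w / p * y * y)) := by
  intro y
  have hp0 : (p : K) ≠ 0 := by exact_mod_cast hp
  have h1 := mul_mem_fractionalIdeal (a * y + a * y + a * a * p) hw
  change ratExp (Algebra.trace ℚ K (w / p * (y + p * a : 𝓞 K) * (y + p * a : 𝓞 K))) =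
    ratExp (Algebra.trace ℚ K (w / p * y * y))
  refine Eq.trans ?_ (ratExp_trace_add h1)
  congr 2
  simp only [coe_integer_mul, coe_integer_add]
  field_simp
  ring

theorem finiteIndex_periods_integral {w : K} (hw : w ∈ inverseDifferent K) {p : 𝓞 K}
    (hp : p ≠ 0) :
    (periods fun y : 𝓞 K ↦ ratExp (Algebra.trace ℚ K (w / p * y * y))).FiniteIndex := by
  have : AddGroup.FG (𝓞 K) := Module.Finite.iff_addGroup_fg.1 inferInstance
  obtain ⟨N, hN, m, hm⟩ := exists_ne_zero_natCast_mem hp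
  refine finiteIndex_periods_of_nsmul hN fun x y ↦ ?_
  have h : N • y = p * (m * y) := by rw [nsmul_eq_mul, hm, mul_comm m, mul_assoc]
  have h1 := mul_mem_periods_integral hw hp (m * y)
  rw [mem_periods] at h1
  rw [h]
  exact h1 x

theorem quadMean_mul {w : K} (hw : w ∈ inverseDifferent K) {n p : 𝓞 K} (hn : n ≠ 0) (hp : p ≠ 0)
    (hnp : IsCoprime n p) (hD : ∀ x ∈ halfDual w, ∃ a : 𝓞 K, (a : K) = n * x) (t : 𝓞 K) :
    quadMean (p * w) t = quadMean w (t * p) * integralMean (t * w / p) := by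
  have hp0 : (p : K) ≠ 0 := by exact_mod_cast hp
  have htw := mul_mem_fractionalIdeal t hw
  rw [quadMean, quadMean, integralMean,
    ← periodicMean_prod (finiteIndex_periods_halfDual hw hn hD _)
      (finiteIndex_periods_integral htw hp)]
  let φ : halfDual w × 𝓞 K →+ halfDual (p * w) := AddMonoidHom.mk'
    (fun x ↦ ⟨x.1 + x.2 / p, by
      have h := add_mem_inverseDifferent (mul_mem_fractionalIdeal p x.1.2)
        (intCast_mem_halfDual hw x.2)
      rw [mem_halfDual]
      convert h using 1
      field_simp⟩) fun x y ↦ by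
      apply Subtype.ext
      change ((x.1 + y.1 : K) + (x.2 + y.2 : 𝓞 K) / p) = (x.1 + x.2 / p) + (y.1 + y.2 / p)
      rw [coe_integer_add]
      ring
  rw [← periodicMean_comp φ]
  · congr 1
    funext ⟨⟨x, hx⟩, y⟩
    rw [← ratExp_add, ← map_add]
    change ratExp (Algebra.trace ℚ K (t * (p * w) * (x + y / p) * (x + y / p))) = _
    refine Eq.trans ?_ (ratExp_trace_add (mul_mem_fractionalIdeal (t * y) hx))
    congr 2
    rw [coe_integer_mul, coe_integer_mul]
    field_simp
    ring
  · rintro ⟨z, hz⟩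
    obtain ⟨a, b, hab⟩ := hnp
    have hab' : (a * n + b * p : K) = 1 := by
      rw [← coe_integer_mul, ← coe_integer_mul, ← coe_integer_add, hab]
      rfl
    have hpz : p * z ∈ halfDual w := by
      rw [mem_halfDual] at hz ⊢
      convert hz using 1
      ring
    obtain ⟨y, hy⟩ := hD _ hpz
    refine ⟨⟨⟨b * (p * z), ?_⟩, a * y⟩, ?_⟩
    · exact Algebra.smul_def b (p * z : K) ▸ Submodule.smul_mem _ b hpz
    · refine (sub_eq_zero.2 ?_ : φ _ - _ = 0) ▸ AddSubgroup.zero_mem _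
      apply Subtype.ext
      change b * (p * z) + (a * y : 𝓞 K) / p = z
      rw [coe_integer_mul, hy]
      field_simp
      linear_combination z * hab'

end QuadraticMean

section LocalMean

theorem sum_comp_sq_add_sum_comp_mul_sq {F : Type*} [Field F] [Fintype F] (h2 : (2 : F) ≠ 0)
    {a : F} (ha : ¬ IsSquare a) {ψ : F → ℂ} (hψ : ∑ x, ψ x = 0) :
    ∑ x, ψ (x ^ 2) + ∑ x, ψ (a * x ^ 2) = 0 := by
  classical
  have hF : ringChar F ≠ 2 := fun h ↦ h2 (by
    have := ringChar.Nat.cast_ringChar (R := F)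
    rwa [h] at this)
  have ha0 : a ≠ 0 := by
    rintro rfl
    exact ha (IsSquare.zero)
  have key (f : F → ℂ) : ∑ x, f (x ^ 2) = ∑ b, (quadraticChar F b + 1 : ℤ) * f b := by
    rw [← Finset.sum_fiberwise (s := Finset.univ) (g := fun x : F ↦ x ^ 2)]
    refine Finset.sum_congr rfl fun b _ ↦ ?_
    rw [← quadraticChar_card_sqrts hF b, Finset.sum_congr rfl (g := fun _ ↦ f b)]
    · rw [Finset.sum_const, nsmul_eq_mul]
      congr 2
      congr 1
      ext x
      simp
    · intro x hx
      rw [(Finset.mem_filter.1 hx).2]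
  rw [key, key fun b ↦ ψ (a * b), ← Equiv.sum_comp (Equiv.mulLeft₀ a ha0), ← Finset.sum_add_distrib]
  have hχ : quadraticChar F a = -1 := (quadraticChar_neg_one_iff_not_isSquare).2 ha
  simp only [Equiv.mulLeft₀_apply, map_mul, hχ, ← add_mul]
  have hψ' : ∑ b, ψ (a * b) = 0 := by
    rw [← hψ]
    exact Equiv.sum_comp (Equiv.mulLeft₀ a ha0) ψ
  rw [← mul_zero (2 : ℂ), ← hψ', Finset.mul_sum]
  refine Finset.sum_congr rfl fun b _ ↦ ?_
  push_cast
  ring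

variable {K : Type*} [Field K] [NumberField K]

theorem integralMean_of_sub_sq {w : K} (hw : w ∈ inverseDifferent K) {p a s t : 𝓞 K} (hp : p ≠ 0)
    (ha : p ∣ a - s ^ 2) (hs : p ∣ s * t - 1) :
    integralMean (a * w / p) = integralMean (w / p) := by
  have hp0 : (p : K) ≠ 0 := by exact_mod_cast hp
  obtain ⟨d, hd⟩ := ha
  obtain ⟨e, he⟩ := hs
  have hd' : (a : K) = s * s + p * d := by
    rw [← coe_integer_mul, ← coe_integer_mul, ← coe_integer_add]
    congr 1
    linear_combination hd
  refine Eq.trans ?_ (periodicMean_comp (AddMonoidHom.mulLeft s) ?_)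
  · rw [integralMean]
    congr 1
    funext y
    change _ = ratExp (Algebra.trace ℚ K (w / p * (s * y : 𝓞 K) * (s * y : 𝓞 K)))
    refine Eq.trans ?_ (ratExp_trace_add (mul_mem_fractionalIdeal (d * y * y) hw))
    congr 2
    simp only [coe_integer_mul, hd']
    field_simp
  · intro y
    refine ⟨t * y, ?_⟩
    have h : AddMonoidHom.mulLeft s (t * y) - y = p * (e * y) := by
      rw [AddMonoidHom.coe_mulLeft]
      linear_combination y * he
    have h1 := mul_mem_periods_integral hw hp (e * y)
    rwa [h]

theorem integralMean_of_not_isSquare {w : K} (hw : w ∈ inverseDifferent K) {p a : 𝓞 K}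
    (hp : p ≠ 0) (hwp : w / p ∉ inverseDifferent K) [hmax : (Ideal.span {p}).IsMaximal]
    (h2 : ¬ p ∣ 2) (ha : ∀ s, ¬ p ∣ a - s ^ 2) :
    integralMean (a * w / p) = -integralMean (w / p) := by
  have hp0 : (p : K) ≠ 0 := by exact_mod_cast hp
  let := Ideal.Quotient.field (Ideal.span {p})
  have := Fintype.ofFinite (𝓞 K ⧸ Ideal.span {p})
  let π := Ideal.Quotient.mk (Ideal.span {p})
  have hπ : Function.Surjective π := Ideal.Quotient.mk_surjective
  let ψ : 𝓞 K ⧸ Ideal.span {p} → ℂ := fun x ↦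
    ratExp (Algebra.trace ℚ K (w / p * (Function.surjInv hπ x)))
  have hψ (y : 𝓞 K) : ψ (π y) = ratExp (Algebra.trace ℚ K (w / p * y)) := by
    have h1 : π (Function.surjInv hπ (π y)) = π y := Function.surjInv_eq hπ _
    rw [Ideal.Quotient.mk_eq_mk_iff_sub_mem, Ideal.mem_span_singleton] at h1
    obtain ⟨d, hd⟩ := h1
    refine Eq.trans ?_ (ratExp_trace_add (mul_mem_fractionalIdeal d hw))
    change ratExp (Algebra.trace ℚ K (w / p * (Function.surjInv hπ (π y)))) = _
    rw [sub_eq_iff_eq_add.1 hd, coe_integer_add, coe_integer_mul]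
    congr 2
    field_simp
    ring
  have hsum : ∑ x, ψ x = 0 := by
    rw [mem_inverseDifferent] at hwp
    push Not at hwp
    obtain ⟨y, hy⟩ := hwp
    have hy1 : ψ (π y) ≠ 1 := by
      rw [hψ, Ne, ratExp_eq_one_iff]
      push Not
      exact hy
    have h1 : ∑ x, ψ x = ψ (π y) * ∑ x, ψ x := by
      rw [Finset.mul_sum, ← Equiv.sum_comp (Equiv.addLeft (π y))]
      refine Finset.sum_congr rfl fun x _ ↦ ?_
      obtain ⟨x, rfl⟩ := hπ x
      change ψ (π y + π x) = _
      rw [← map_add, hψ, hψ, hψ, ← ratExp_add, ← map_add, coe_integer_add,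
        mul_add]
    by_contra h0
    exact hy1 (mul_right_cancel₀ h0 (by rw [one_mul, ← h1]))
  have h2' : (2 : 𝓞 K ⧸ Ideal.span {p}) ≠ 0 := by
    rw [← map_ofNat π 2, Ne, Ideal.Quotient.eq_zero_iff_dvd]
    exact h2
  have ha' : ¬ IsSquare (π a) := by
    rintro ⟨s, hs⟩
    obtain ⟨s, rfl⟩ := hπ s
    rw [← map_mul, ← sq, Ideal.Quotient.mk_eq_mk_iff_sub_mem, Ideal.mem_span_singleton] at hs
    exact ha s hs
  have key := sum_comp_sq_add_sum_comp_mul_sq h2' ha' hsum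
  have h₁ (y : 𝓞 K) : ratExp (Algebra.trace ℚ K (a * w / p * y * y)) = ψ (π a * π y ^ 2) := by
    rw [← map_pow, ← map_mul, hψ, sq, coe_integer_mul, coe_integer_mul]
    congr 2
    ring
  have h₂ (y : 𝓞 K) : ratExp (Algebra.trace ℚ K (w / p * y * y)) = ψ (π y ^ 2) := by
    rw [← map_pow, hψ, sq, coe_integer_mul, mul_assoc]
  rw [integralMean, integralMean,
    periodicMean_eq_sum_of_surjective π.toAddMonoidHom hπ (fun x ↦ ψ (π a * x ^ 2)) h₁,
    periodicMean_eq_sum_of_surjective π.toAddMonoidHom hπ (fun x ↦ ψ (x ^ 2)) h₂,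
    eq_neg_of_add_eq_zero_right key, neg_div]

end LocalMean

section Reciprocity

variable {K : Type*} [Field K] [NumberField K]

theorem mem_halfDual_iff_trace {w x : K} : x ∈ halfDual w ↔
    ∀ y ∈ (algebraMap (𝓞 K) K).range.toAddSubgroup, ∃ n : ℤ,
      2 * Algebra.trace ℚ K (w * x * y) = n := by
  have h (y : K) : 2 * Algebra.trace ℚ K (w * x * y) = Algebra.trace ℚ K (2 * w * x * y) := by
    rw [two_mul, ← map_add]
    congr 1
    ring
  simp only [h]
  constructor
  · rintro hx _ ⟨y, rfl⟩
    exact mem_inverseDifferent.1 hx y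
  · exact fun hx ↦ mem_inverseDifferent.2 fun y ↦ hx y ⟨y, rfl⟩

theorem quadMean_one (w : K) :
    quadMean w 1 = periodicMean fun x : halfDual w ↦ ratExp (Algebra.trace ℚ K (w * x * x)) := by
  rw [quadMean]
  congr 1
  funext x
  congr 2
  exact congrArg (· * (x : K) * x) (one_mul w)

theorem exists_quadMean_mul_eq {p : 𝓞 K} (hp : ∀ σ : K →+* ℝ, 0 < σ p) (hp0 : p ≠ 0) {w : K}
    (hw0 : w ≠ 0) (hw : w ∈ inverseDifferent K) :
    ∃ r : ℝ, 0 < r ∧ quadMean (p * w) 1 = r * quadMean w 1 ∧ quadMean w 1 ≠ 0 := by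
  have hint (v : K) (hv : v ∈ inverseDifferent K) :
      ∀ x ∈ (algebraMap (𝓞 K) K).range.toAddSubgroup,
        ∃ n : ℤ, Algebra.trace ℚ K (v * x * x) = n := by
    rintro _ ⟨x, rfl⟩
    have h := mul_mem_fractionalIdeal (x * x) hv
    rw [coe_integer_mul, mul_comm, ← mul_assoc] at h
    exact exists_trace_eq_of_mem_inverseDifferent h
  have hL (x : K) : ∃ n : ℕ, n ≠ 0 ∧ n • x ∈ (algebraMap (𝓞 K) K).range.toAddSubgroup := by
    obtain ⟨a, b, hb, rfl⟩ := IsFractionRing.div_surjective (A := 𝓞 K) x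
    have hb0 := nonZeroDivisors.ne_zero hb
    obtain ⟨N, hN, m, hm⟩ := exists_ne_zero_natCast_mem hb0
    refine ⟨N, hN, m * a, ?_⟩
    have hb1 : algebraMap (𝓞 K) K b ≠ 0 := by simpa using hb0
    rw [nsmul_eq_mul, ← map_natCast (algebraMap (𝓞 K) K), hm, map_mul, map_mul]
    field_simp
  rw [quadMean_one, quadMean_one]
  exact exists_periodicMean_mul_eq hp (by exact_mod_cast hp0) hw0 hL (hint w hw)
    (hint _ (mul_mem_fractionalIdeal p hw))
    (Λ := (halfDual w).toAddSubgroup) (Λ' := (halfDual (p * w)).toAddSubgroup)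
    (fun _ ↦ mem_halfDual_iff_trace) (fun _ ↦ mem_halfDual_iff_trace)

theorem quadMean_mul_quadMean {w : K} (hw : w ∈ inverseDifferent K) {n a b x y m : 𝓞 K}
    (hn : n ≠ 0) (hD : ∀ x ∈ halfDual w, ∃ a : 𝓞 K, (a : K) = n * x)
    (h : a * x ^ 2 + b * y ^ 2 - 1 = m * (2 * n)) :
    quadMean w a * quadMean w b = quadMean w 1 * quadMean w (a * b) := by
  have hfin := finiteIndex_periods_halfDual hw hn hD
  rw [quadMean, quadMean, quadMean, quadMean, ← periodicMean_prod (hfin _) (hfin _),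
    ← periodicMean_prod (hfin _) (hfin _)]
  have hK : (a * (x * x) + b * (y * y) : K) = 1 + m * (2 * n) := by
    have h' : a * (x * x) + b * (y * y) = 1 + m * (n + n) := by linear_combination h
    have h'' := congrArg (fun z : 𝓞 K ↦ (z : K)) h'
    simp only [coe_integer_add, coe_integer_mul] at h''
    rw [h'', two_mul]
    rfl
  let φ : halfDual w × halfDual w →+ halfDual w × halfDual w := AddMonoidHom.mk'
    (fun z ↦ (x • z.1 - (b * y) • z.2, y • z.1 + (a * x) • z.2)) fun z z' ↦ by
      apply Prod.ext
      · simp only [Prod.fst_add, Prod.snd_add, smul_add]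
        abel
      · simp only [Prod.fst_add, Prod.snd_add, smul_add]
        abel
  refine (Eq.trans ?_ (periodicMean_comp φ ?_)).symm
  · congr 1
    funext ⟨⟨X, hX⟩, ⟨Y, hY⟩⟩
    obtain ⟨X', hX'⟩ := hD X hX
    obtain ⟨Y', hY'⟩ := hD Y hY
    have hXY := add_mem_inverseDifferent (mul_mem_fractionalIdeal (m * X') hX)
      (mul_mem_fractionalIdeal (m * Y' * (a * b)) hY)
    change ratExp (Algebra.trace ℚ K ((1 : 𝓞 K) * w * X * X)) *
        ratExp (Algebra.trace ℚ K ((a * b : 𝓞 K) * w * Y * Y)) =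
      ratExp (Algebra.trace ℚ K (a * w * (x * X - (b * y : 𝓞 K) * Y) *
        (x * X - (b * y : 𝓞 K) * Y))) *
      ratExp (Algebra.trace ℚ K (b * w * (y * X + (a * x : 𝓞 K) * Y) *
        (y * X + (a * x : 𝓞 K) * Y)))
    rw [← ratExp_add, ← map_add, ← ratExp_add, ← map_add]
    refine (Eq.trans ?_ (ratExp_trace_add hXY)).symm
    congr 2
    simp only [coe_integer_mul, hX', hY']
    have h1 : ((1 : 𝓞 K) : K) = 1 := rfl
    rw [h1]
    linear_combination (w * X * X + w * a * b * Y * Y) * hK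
  · rintro ⟨A, B⟩
    obtain ⟨A', hA'⟩ := hD A A.2
    obtain ⟨B', hB'⟩ := hD B B.2
    refine ⟨((a * x) • A + (b * y) • B, - y • A + x • B), ?_⟩
    have h1 := intCast_mem_periods hw a (m * (A' + A'))
    have h2 := intCast_mem_periods hw b (m * (B' + B'))
    rw [mem_periods] at h1 h2
    have h3 : φ ((a * x) • A + (b * y) • B, - y • A + x • B) - (A, B) =
        (⟨_, intCast_mem_halfDual hw (m * (A' + A'))⟩,
          ⟨_, intCast_mem_halfDual hw (m * (B' + B'))⟩) := by
      apply Prod.ext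
      · apply Subtype.ext
        change (x : K) * ((a * x : 𝓞 K) * (A : K) + (b * y : 𝓞 K) * (B : K)) - (b * y : 𝓞 K) *
          ((-y : 𝓞 K) * (A : K) + x * (B : K)) - A = ((m * (A' + A') : 𝓞 K) : K)
        have hy : ((-y : 𝓞 K) : K) = -y := rfl
        simp only [coe_integer_mul, coe_integer_add, hA', hy]
        linear_combination A * hK
      · apply Subtype.ext
        change (y : K) * ((a * x : 𝓞 K) * (A : K) + (b * y : 𝓞 K) * (B : K)) + (a * x : 𝓞 K) *
          ((-y : 𝓞 K) * (A : K) + x * (B : K)) - B = ((m * (B' + B') : 𝓞 K) : K)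
        have hy : ((-y : 𝓞 K) : K) = -y := rfl
        simp only [coe_integer_mul, coe_integer_add, hB', hy]
        linear_combination B * hK
    rw [h3, mem_periods]
    rintro ⟨X, Y⟩
    exact congrArg₂ (· * ·) (h1 X) (h2 Y)

end Reciprocity

section Conclusion

theorem HeightOneSpectrum.eq_of_mem_of_span {R : Type*} [CommRing R] [IsDedekindDomain R] {p : R}
    {v w : HeightOneSpectrum R} (hv : v.asIdeal = Ideal.span {p}) (hp : p ∈ w.asIdeal) : v = w := by
  apply HeightOneSpectrum.ext
  apply v.isMaximal.eq_of_le w.isPrime.ne_top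
  rwa [hv, Ideal.span_singleton_le_iff_mem]

theorem isCoprime_of_not_dvd {R : Type*} [CommRing R] {p a : R} [(Ideal.span {p}).IsMaximal]
    (h : ¬ p ∣ a) : IsCoprime p a := by
  obtain ⟨b, hb⟩ := exists_mul_sub_one_mem_pow (mt Ideal.mem_span_singleton.1 h) 1
  rw [pow_one, Ideal.mem_span_singleton] at hb
  obtain ⟨d, hd⟩ := hb
  exact ⟨-d, b, by linear_combination hd⟩

end Conclusion

/-- Let `p₁, p₂` be odd prime elements of `𝓞 K` with distinct places.  If `p₁` is totally
positive, `p₁` is a square in `K_v` for every `v` above `2`, and `p₂` is a square in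
`K_{v_{p₁}}`, then `p₁` is a square in `K_{v_{p₂}}`. -/
theorem isSquare_of_isSquare_reciprocity
    (K : Type*) [Field K] [NumberField K]
    (p₁ p₂ : 𝓞 K) (hp₁ : Prime p₁) (hp₂ : Prime p₂)
    (v₁ v₂ : HeightOneSpectrum (𝓞 K))
    (hv₁ : v₁.asIdeal = Ideal.span {p₁}) (hv₂ : v₂.asIdeal = Ideal.span {p₂})
    (hodd₁ : (2 : 𝓞 K) ∉ v₁.asIdeal) (hodd₂ : (2 : 𝓞 K) ∉ v₂.asIdeal)
    (hne : v₁ ≠ v₂)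
    (hpos : ∀ σ : K →+* ℝ, 0 < σ (algebraMap (𝓞 K) K p₁))
    (h2 : ∀ v : HeightOneSpectrum (𝓞 K), (2 : 𝓞 K) ∈ v.asIdeal →
      IsSquare (algebraMap (𝓞 K) (v.adicCompletion K) p₁))
    (hsq : IsSquare (algebraMap (𝓞 K) (v₁.adicCompletion K) p₂)) :
    IsSquare (algebraMap (𝓞 K) (v₂.adicCompletion K) p₁) := by
  have hmem₁ (a : 𝓞 K) : a ∈ v₁.asIdeal ↔ p₁ ∣ a := by rw [hv₁, Ideal.mem_span_singleton]
  have hmem₂ (a : 𝓞 K) : a ∈ v₂.asIdeal ↔ p₂ ∣ a := by rw [hv₂, Ideal.mem_span_singleton]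
  have hmax₁ : (Ideal.span {p₁}).IsMaximal := hv₁ ▸ v₁.isMaximal
  have hmax₂ : (Ideal.span {p₂}).IsMaximal := hv₂ ▸ v₂.isMaximal
  rw [hmem₁] at hodd₁
  rw [hmem₂] at hodd₂
  have h₁₂ : ¬ p₁ ∣ p₂ := fun h ↦
    hne (HeightOneSpectrum.eq_of_mem_of_span hv₂ ((hmem₁ _).2 h)).symm
  have h₂₁ : ¬ p₂ ∣ p₁ := fun h ↦ hne (HeightOneSpectrum.eq_of_mem_of_span hv₁ ((hmem₂ _).2 h))
  by_cases hs : ∃ s, p₂ ∣ p₁ - s ^ 2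
  · obtain ⟨s, hs⟩ := hs
    have hs2 : ¬ p₂ ∣ 2 * s := fun h ↦ h₂₁ ((hp₂.dvd_or_dvd h).elim (fun h ↦ (hodd₂ h).elim)
      fun h ↦ (dvd_sub_comm.1 hs |> fun h' ↦ (dvd_sub_right (dvd_pow h two_ne_zero)).1 h'))
    obtain ⟨a, b, hab⟩ := isCoprime_of_not_dvd hs2
    exact isSquare_of_sub_sq_mem v₂ (s := s) (w := b) ((hmem₂ _).2 hs)
      ((hmem₂ _).2 ⟨-a, by linear_combination hab⟩)
  exfalso
  push Not at hs
  have hc₁₂ := isCoprime_of_not_dvd h₁₂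
  obtain ⟨c, hc, hcp₁, hcp₂⟩ := exists_mem_inverseDifferent_div_notMem hp₁ hp₂ hc₁₂
  obtain ⟨n, hn₁, hn₂, hD⟩ := exists_denominator_not_dvd_not_dvd hp₁ hp₂ hc₁₂
    (isCoprime_of_not_dvd hodd₁) (isCoprime_of_not_dvd hodd₂) hc hcp₁ hcp₂
  have hn0 : n ≠ 0 := fun h ↦ hn₁ (h ▸ dvd_zero _)
  have hc0 : c ≠ 0 := by
    rintro rfl
    exact hcp₁ (by rwa [zero_div])
  have hp₂0 : (p₂ : K) ≠ 0 := by exact_mod_cast hp₂.ne_zero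
  have hpc := mul_mem_fractionalIdeal p₂ hc
  have hn2 : 2 * n ≠ 0 := mul_ne_zero two_ne_zero hn0
  obtain ⟨x, y, hxy⟩ : ∃ x y, p₁ * x ^ 2 + p₂ * y ^ 2 - 1 ∈ Ideal.span {2 * n} := by
    refine exists_mul_sq_add_mul_sq_sub_one_mem (fun v ↦ ?_)
      (fun v hv k ↦ exists_sub_sq_mem_pow v (h2 v hv) k) _ (by simpa using hn0) fun v hv ↦ ⟨?_, ?_⟩
    · have := v.isMaximal
      infer_instance
    · intro h
      obtain rfl := HeightOneSpectrum.eq_of_mem_of_span hv₁ h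
      rw [Ideal.span_singleton_le_iff_mem, hmem₁] at hv
      exact (hp₁.dvd_or_dvd hv).elim hodd₁ hn₁
    · intro h
      obtain rfl := HeightOneSpectrum.eq_of_mem_of_span hv₂ h
      rw [Ideal.span_singleton_le_iff_mem, hmem₂] at hv
      exact (hp₂.dvd_or_dvd hv).elim hodd₂ hn₂
  obtain ⟨m, hm⟩ := Ideal.mem_span_singleton'.1 hxy
  have hprod := quadMean_mul_quadMean hc hn0 hD hm.symm
  have hS₁ := quadMean_mul hc hn0 hp₁.ne_zero (isCoprime_of_not_dvd hn₁).symm hD 1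
  have hS₂ := quadMean_mul hc hn0 hp₂.ne_zero (isCoprime_of_not_dvd hn₂).symm hD 1
  have hS₂₁ := quadMean_mul hc hn0 hp₂.ne_zero (isCoprime_of_not_dvd hn₂).symm hD p₁
  have hD' : ∀ x ∈ halfDual (p₂ * c), ∃ a : 𝓞 K, (a : K) = (n * p₂ : 𝓞 K) * x := fun x hx ↦ by
    have hx' : p₂ * x ∈ halfDual c := by
      rw [mem_halfDual] at hx ⊢
      convert hx using 1
      ring
    obtain ⟨a, ha⟩ := hD _ hx'
    exact ⟨a, by rw [ha, coe_integer_mul, mul_assoc]⟩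
  have hS₁₂ := quadMean_mul hpc (mul_ne_zero hn0 hp₂.ne_zero) hp₁.ne_zero
    ((isCoprime_of_not_dvd hn₁).symm.mul_left hc₁₂.symm) hD' 1
  obtain ⟨s, hs'⟩ := exists_sub_sq_mem_pow v₁ hsq 1
  rw [pow_one, hmem₁] at hs'
  have hsp : ¬ p₁ ∣ s := fun h ↦ h₁₂ ((dvd_sub_left (dvd_pow h two_ne_zero)).1 hs')
  obtain ⟨a, t, hat⟩ := isCoprime_of_not_dvd hsp
  have hB := integralMean_of_sub_sq hc hp₁.ne_zero hs' (t := t)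
    ⟨-a, by linear_combination hat⟩
  have hC := integralMean_of_not_isSquare hc hp₂.ne_zero hcp₂ hodd₂ hs
  obtain ⟨r, hr, hM₁, hA⟩ := exists_quadMean_mul_eq hpos hp₁.ne_zero hc0 hc
  obtain ⟨r', hr', hM₁₂, hM₂⟩ := exists_quadMean_mul_eq hpos hp₁.ne_zero
    (mul_ne_zero hp₂0 hc0) hpc
  have h1K : ((1 : 𝓞 K) : K) = 1 := rfl
  rw [h1K, one_mul, one_mul] at hS₁ hS₂ hS₁₂
  rw [hB] at hS₁₂
  rw [hC] at hS₂₁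
  rw [hS₂₁] at hS₁₂
  have key : ((r + r' : ℝ) : ℂ) * (quadMean c 1 * quadMean (p₂ * c) 1) = 0 := by
    push_cast
    linear_combination (-quadMean (p₂ * c) 1) * hM₁ + (-quadMean c 1) * hM₁₂ +
      quadMean (p₂ * c) 1 * hS₁ + quadMean c p₁ * integralMean (c / p₁) * hS₂ +
      quadMean c 1 * hS₁₂ + integralMean (c / p₁) * integralMean (c / p₂) * hprod
  rcases mul_eq_zero.1 key with h | h
  · have h' : r + r' = 0 := by exact_mod_cast h
    linarith
  · exact mul_ne_zero hA hM₂ h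
end
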